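/- arXiv:2511.00394 — 2 statements merged into one kernel-verified Lean document; each statement's English description precedes it below -/
import Mathlib

section
/- Let n be a prime number, q = 2^n, and G = PSL(2, F_q) the projective special linear group of degree 2 over the field with q elements. Then a subgroup H of G fails to be pronormal in G if and only if there exists an integer j with 1 ≤ j < n such that H is isomorphic to the elementary abelian group (ℤ/2ℤ)^j. In particular, every subgroup of G not of this form is pronormal in G. -/
/-- The conjugate `H^g := g⁻¹ H g` of a subgroup `H` by an element `g`. -/
def Subgroup.conjugate {G : Type*} [Group G] (H : Subgroup G) (g : G) : Subgroup G :=
  H.map (MulAut.conj g⁻¹).toMonoidHom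

/-- A subgroup `H` of a group `G` is pronormal in `G` if for every `g ∈ G` there exists
`x ∈ ⟨H, H^g⟩` such that `H^x = H^g`. -/
def IsPronormal {G : Type*} [Group G] (H : Subgroup G) : Prop :=
  ∀ g : G, ∃ x ∈ (H ⊔ H.conjugate g : Subgroup G), H.conjugate x = H.conjugate g

structure Good (n : ℕ) (G : Type*) [Group G] : Prop where
  ca : ∀ x a b : G, x ≠ 1 → Commute a x → Commute b x → Commute a b
  inv : ∀ x c : G, x ≠ 1 → x * x = 1 → Commute c x → c * c = 1
  fus : ∀ p h : G, Commute (h * p * h⁻¹) p →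
    ((h * p * h⁻¹)⁻¹ * p) ^ 2 = 1 ∨ ((h * p * h⁻¹) * p) ^ 2 = 1
  gen : ∀ x y : G, x * x = 1 → y * y = 1 → ¬ Commute x y → ∀ K : Subgroup G,
    (∀ c, Commute c x → c ∈ K) → (∀ c, Commute c y → c ∈ K) → K = ⊤
  card : ∀ x : G, x ≠ 1 → x * x = 1 → Nat.card (Subgroup.centralizer {x}) = 2 ^ n
  full : ∀ x h : G, x ≠ 1 → x * x = 1 → ∀ S : Subgroup G, x ∈ S → (∀ s ∈ S, Commute s x) →
    (∀ s ∈ S, h * s * h⁻¹ ∈ S) → ¬ Commute h x → ∀ c, Commute c x → c ∈ S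
  tor : ∀ x g h : G, x ≠ 1 → x * x = 1 → Commute (g * x * g⁻¹) x → Commute (h * x * h⁻¹) x →
    (g * h) * x * (g * h)⁻¹ = (h * g) * x * (h * g)⁻¹
  ex : ∀ x : G, x ≠ 1 → x * x = 1 → ∃ y : G, y * y = 1 ∧ ¬ Commute x y

theorem mem_conjugate {G : Type*} [Group G] (H : Subgroup G) (g y : G) :
    y ∈ H.conjugate g ↔ g * y * g⁻¹ ∈ H := by
  unfold Subgroup.conjugate
  constructor
  · rintro ⟨h, hh, rfl⟩
    simpa [mul_assoc] using hh
  · intro h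
    exact ⟨_, h, by simp [mul_assoc]⟩

theorem conj_mem_conjugate {G : Type*} [Group G] (H : Subgroup G) (g y : G) (hy : y ∈ H) :
    g⁻¹ * y * g ∈ H.conjugate g := by
  rw [mem_conjugate]; simpa [mul_assoc] using hy

theorem conjugate_mul {G : Type*} [Group G] (H : Subgroup G) (g x : G) :
    H.conjugate (g * x) = (H.conjugate g).conjugate x := by
  ext y; simp [mem_conjugate, mul_assoc]

theorem card_conjugate {G : Type*} [Group G] (H : Subgroup G) (g : G) :
    Nat.card (H.conjugate g) = Nat.card H := by
  unfold Subgroup.conjugate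
  exact Subgroup.card_map_of_injective (MulAut.conj g⁻¹).injective

theorem conjugate_eq_of_le {G : Type*} [Group G] [Finite G] (H : Subgroup G) (g y : G)
    (h : H.conjugate g ≤ H.conjugate y) : H.conjugate y = H.conjugate g :=
  (Subgroup.eq_of_le_of_card_ge h (by rw [card_conjugate, card_conjugate])).symm

theorem conjugate_one {G : Type*} [Group G] (H : Subgroup G) : H.conjugate 1 = H := by
  ext y; simp [mem_conjugate]

theorem conj_le_sup {G : Type*} [Group G] (H : Subgroup G) (g x : G)
    (hx : x ∈ H ⊔ H.conjugate g) : H ⊔ H.conjugate (g * x) ≤ H ⊔ H.conjugate g := by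
  refine sup_le le_sup_left ?_
  intro y hy
  rw [conjugate_mul, mem_conjugate] at hy
  have h1 : x * y * x⁻¹ ∈ H ⊔ H.conjugate g := (le_sup_right : _ ≤ H ⊔ H.conjugate g) hy
  have h2 := mul_mem (mul_mem (inv_mem hx) h1) hx
  simpa [mul_assoc] using h2

open scoped commutatorElement

set_option linter.unusedSectionVars false

namespace Good

variable {n : ℕ} {G : Type*} [Group G] [Finite G]

theorem even_or_odd (hG : Good n G) (g : G) : g * g = 1 ∨ Odd (orderOf g) := by
  rcases Nat.even_or_odd (orderOf g) with h | h
  · left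
    obtain ⟨k, hk⟩ := h
    have hpos := orderOf_pos g
    have h1 : g ^ k * g ^ k = 1 := by rw [← pow_add, ← hk, pow_orderOf_eq_one]
    have h2 : g ^ k ≠ 1 := pow_ne_one_of_lt_orderOf (by omega) (by omega)
    exact hG.inv _ g h2 h1 ((Commute.refl g).pow_right k)
  · exact Or.inr h

theorem fus' (hG : Good n G) (p h : G) (hp : Odd (orderOf p)) (hc : Commute (h * p * h⁻¹) p) :
    h * p * h⁻¹ = p ∨ h * p * h⁻¹ = p⁻¹ := by
  have key : ∀ z : G, z ^ 2 = 1 → z ^ orderOf p = 1 → z = 1 := by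
    intro z h2 h3
    have := Nat.dvd_gcd (orderOf_dvd_of_pow_eq_one h2) (orderOf_dvd_of_pow_eq_one h3)
    rw [(Nat.coprime_two_left.2 hp : Nat.gcd 2 _ = 1)] at this
    exact orderOf_eq_one_iff.1 (Nat.dvd_one.1 this)
  have hx : (h * p * h⁻¹) ^ orderOf p = 1 := by
    rw [conj_pow, pow_orderOf_eq_one]; simp
  rcases hG.fus p h hc with h1 | h1
  · left
    have := key _ h1 (by rw [hc.inv_left.mul_pow, inv_pow, hx, pow_orderOf_eq_one]; simp)
    exact inv_mul_eq_one.1 this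
  · right
    have := key _ h1 (by rw [hc.mul_pow, hx, pow_orderOf_eq_one]; simp)
    exact mul_eq_one_iff_eq_inv.1 this

theorem conj_invol (hG : Good n G) (x y : G) (hx : x * x = 1) (hy : y * y = 1)
    (hxy : ¬ Commute x y) : ∃ k : ℕ, ((x * y) ^ k)⁻¹ * x * (x * y) ^ k = y := by
  have hxi : x⁻¹ = x := inv_eq_of_mul_eq_one_left hx
  have hyi : y⁻¹ = y := inv_eq_of_mul_eq_one_left hy
  rcases hG.even_or_odd (x * y) with h | h
  · exfalso
    apply hxy
    have := inv_eq_of_mul_eq_one_left h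
    rw [mul_inv_rev, hxi, hyi] at this
    exact this.symm
  · obtain ⟨m, hm⟩ := h
    refine ⟨m + 1, ?_⟩
    have h1 : ∀ k : ℕ, ((x * y) ^ k)⁻¹ * x = x * (x * y) ^ k := by
      intro k
      rw [← inv_pow, mul_inv_rev, hxi, hyi]
      have : x * (x * y) ^ k * x⁻¹ = (y * x) ^ k := by
        rw [← conj_pow]; congr 1; rw [hxi, ← mul_assoc, hx, one_mul]
      rw [← this, hxi, mul_assoc, hx, mul_one]
    rw [h1, mul_assoc, ← pow_add, show m + 1 + (m + 1) = orderOf (x * y) + 1 by omega,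
      pow_succ, pow_orderOf_eq_one, one_mul, ← mul_assoc, hx, one_mul]

theorem pgroup_comm (hG : Good n G) (r : ℕ) [Fact r.Prime] (P : Subgroup G) (hP : IsPGroup r P)
    (a b : G) (ha : a ∈ P) (hb : b ∈ P) : Commute a b := by
  by_cases hn : Nontrivial P
  · have := hP.center_nontrivial
    obtain ⟨⟨z, hz⟩, hz1⟩ := exists_ne (1 : Subgroup.center P)
    have hz' := Subgroup.mem_center_iff.1 hz
    refine hG.ca (z : G) a b ?_ ?_ ?_
    · intro h; apply hz1; ext; simpa using h
    · exact congrArg Subtype.val (hz' ⟨a, ha⟩)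
    · exact congrArg Subtype.val (hz' ⟨b, hb⟩)
  · rw [not_nontrivial_iff_subsingleton] at hn
    have : (⟨a, ha⟩ : P) = ⟨b, hb⟩ := Subsingleton.elim _ _
    rw [Subtype.mk.injEq] at this
    rw [this]

theorem odd_comm {N : Type*} [Group N] [Finite N] (hodd : Odd (Nat.card N))
    (ca : ∀ x a b : N, x ≠ 1 → Commute a x → Commute b x → Commute a b)
    (fus : ∀ p h : N, Commute (h * p * h⁻¹) p → h * p * h⁻¹ = p ∨ h * p * h⁻¹ = p⁻¹)
    (a b : N) : Commute a b := by
  have hord : ∀ x : N, Odd (orderOf x) := fun x => hodd.of_dvd_nat (orderOf_dvd_natCard x)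
  by_contra hab
  have hz : ⁅a, b⁆ ≠ 1 := fun h => hab (commutatorElement_eq_one_iff_commute.1 h)
  have h1 : orderOf ⁅a, b⁆ ≠ 1 := fun h => hz (orderOf_eq_one_iff.1 h)
  obtain ⟨r, hr, hrd⟩ := Nat.exists_prime_and_dvd h1
  have : Fact r.Prime := ⟨hr⟩
  obtain P : Sylow r N := default
  have hcomm : ∀ a b : N, a ∈ P → b ∈ P → Commute a b := by
    intro a b ha hb
    by_cases hn : Nontrivial P
    · have := P.isPGroup'.center_nontrivial
      obtain ⟨⟨z, hz⟩, hz1⟩ := exists_ne (1 : Subgroup.center P)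
      have hz' := Subgroup.mem_center_iff.1 hz
      refine ca (z : N) a b ?_ ?_ ?_
      · intro h; apply hz1; ext; simpa using h
      · exact congrArg Subtype.val (hz' ⟨a, ha⟩)
      · exact congrArg Subtype.val (hz' ⟨b, hb⟩)
    · rw [not_nontrivial_iff_subsingleton] at hn
      have : (⟨a, ha⟩ : P) = ⟨b, hb⟩ := Subsingleton.elim _ _
      rw [Subtype.mk.injEq] at this
      rw [this]
  have hP : Subgroup.normalizer (P : Set N) ≤ Subgroup.centralizer (P : Set N) := by
    intro h hh
    rw [Subgroup.mem_centralizer_iff]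
    intro p hp
    have hhp : h * p * h⁻¹ ∈ P := (Subgroup.mem_normalizer_iff.1 hh p).1 hp
    rcases fus p h (hcomm _ _ hhp hp) with h2 | h2
    · exact (mul_inv_eq_iff_eq_mul.1 h2).symm
    · have h3 : Commute (h * h) p := by
        have : (h * h) * p * (h * h)⁻¹ = p := by
          calc (h * h) * p * (h * h)⁻¹ = h * (h * p * h⁻¹) * h⁻¹ := by group
            _ = h * p⁻¹ * h⁻¹ := by rw [h2]
            _ = (h * p * h⁻¹)⁻¹ := by group
            _ = p := by rw [h2, inv_inv]
        exact mul_inv_eq_iff_eq_mul.1 this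
      obtain ⟨m, hm⟩ := hord h
      have h4 : h = (h * h) ^ (m + 1) := by
        rw [← pow_two, ← pow_mul, show 2 * (m + 1) = orderOf h + 1 by omega, pow_succ,
          pow_orderOf_eq_one, one_mul]
      have h5 : Commute h p := by rw [h4]; exact h3.pow_left _
      exact h5.symm
  have hker : ⁅a, b⁆ ∈ (MonoidHom.transferSylow P hP).ker := by
    rw [MonoidHom.mem_ker, map_commutatorElement, commutatorElement_eq_one_iff_commute]
    exact Subtype.ext (hcomm _ _ (SetLike.coe_mem _) (SetLike.coe_mem _))
  apply MonoidHom.not_dvd_card_ker_transferSylow P hP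
  exact hrd.trans ((Subgroup.orderOf_dvd_natCard _ hker))

end Good

namespace Good

variable {n : ℕ} {G : Type*} [Group G] [Finite G]

/-- the dihedral / cyclic case after conjugating -/
theorem dih_core (hG : Good n G) (H : Subgroup G) (a : G) (ha1 : a ≠ 1)
    (hodd : Odd (orderOf a)) (hinv : ∀ h ∈ H, h * a * h⁻¹ = a ∨ h * a * h⁻¹ = a⁻¹) (g : G)
    (hg : g⁻¹ * a * g = a ∨ g⁻¹ * a * g = a⁻¹) :
    ∃ y ∈ H ⊔ H.conjugate g, H.conjugate y = H.conjugate g := by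
  have haa : ∀ z : G, Commute z a → z * z = 1 → z = 1 := by
    intro z hz hzz
    by_contra hz1
    have h1 := hG.inv z a hz1 hzz hz.symm
    rw [← pow_two] at h1
    have h2 := Nat.dvd_gcd (orderOf_dvd_of_pow_eq_one h1) dvd_rfl
    rw [(Nat.coprime_two_left.2 hodd : Nat.gcd 2 _ = 1)] at h2
    exact ha1 (orderOf_eq_one_iff.1 (Nat.dvd_one.1 h2))
  have hga : ∀ c : G, Commute c a → Commute (g⁻¹ * c * g) a := by
    intro c hc
    have h1 : Commute (g⁻¹ * c * g) (g⁻¹ * a * g) := by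
      have := (hc.map (MulAut.conj g⁻¹))
      simpa using this
    rcases hg with h | h
    · rwa [h] at h1
    · rw [h] at h1; simpa using h1
  have hC : ∀ c : G, Commute c a → g⁻¹ * c * g = c ∨ g⁻¹ * c * g = c⁻¹ := by
    intro c hc
    have ho : Odd (orderOf c) := by
      rcases hG.even_or_odd c with h | h
      · rw [haa c hc h]; simp
      · exact h
    have := hG.fus' c g⁻¹ ho (by rw [inv_inv]; exact hG.ca a _ _ ha1 (hga c hc) hc)
    simpa using this
  by_cases hall : ∀ h ∈ H, Commute h a
  · refine ⟨1, one_mem _, ?_⟩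
    apply conjugate_eq_of_le
    rw [conjugate_one]
    intro y hy
    rw [mem_conjugate] at hy
    rcases hC _ (hall _ hy) with h | h
    · have : y = g * y * g⁻¹ := by rw [← h]; group
      rw [this]; exact hy
    · have : y = (g * y * g⁻¹)⁻¹ := by rw [← h]; group
      rw [this]; exact inv_mem hy
  · push Not at hall
    obtain ⟨s, hs, hsa⟩ := hall
    have hnc : ∀ h ∈ H, ¬ Commute h a → h * a = a⁻¹ * h := by
      intro h hh hc
      rcases hinv h hh with h1 | h1
      · exact absurd (mul_inv_eq_iff_eq_mul.1 h1) hc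
      · exact mul_inv_eq_iff_eq_mul.1 h1
    have hmul : ∀ u v : G, u * a = a⁻¹ * u → v * a = a⁻¹ * v → Commute (u * v) a := by
      intro u v hu hv
      have hu' : u * a⁻¹ = a * u := by
        rw [mul_inv_eq_iff_eq_mul, mul_assoc, hu, mul_inv_cancel_left]
      show u * v * a = a * (u * v)
      rw [mul_assoc, hv, ← mul_assoc, hu', mul_assoc]
    have hsinv := hnc s hs hsa
    have hss : s * s = 1 := by
      by_contra h1
      exact hsa (hG.ca (s * s) s a h1 ((Commute.refl s).mul_right (Commute.refl s))
        (hmul s s hsinv hsinv).symm)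
    set s' := g⁻¹ * s * g with hs'
    have hs's' : s' * s' = 1 := by
      rw [hs']
      calc g⁻¹ * s * g * (g⁻¹ * s * g) = g⁻¹ * (s * s) * g := by group
        _ = 1 := by rw [hss]; group
    have hs'inv : s' * a = a⁻¹ * s' := by
      have h1 : s' * (g⁻¹ * a * g) = (g⁻¹ * a * g)⁻¹ * s' := by
        rw [hs']
        calc g⁻¹ * s * g * (g⁻¹ * a * g) = g⁻¹ * (s * a) * g := by group
          _ = _ := by rw [hsinv]; group
      rcases hg with h | h
      · rwa [h] at h1
      · rw [h, inv_inv] at h1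
        calc s' * a = a⁻¹ * (a * s') * a := by group
          _ = a⁻¹ * (s' * a⁻¹) * a := by rw [h1]
          _ = a⁻¹ * s' := by group
    have hu : Commute (s * s') a := hmul s s' hsinv hs'inv
    have hmem : s * s' ∈ H ⊔ H.conjugate g :=
      mul_mem ((le_sup_left : H ≤ _) hs) ((le_sup_right : _ ≤ H ⊔ H.conjugate g)
        (conj_mem_conjugate H g s hs))
    obtain ⟨y, hyK, hya, hys⟩ : ∃ y ∈ H ⊔ H.conjugate g, Commute y a ∧ y⁻¹ * s * y = s' := by
      by_cases hc : Commute s s'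
      · refine ⟨1, one_mem _, Commute.one_left _, ?_⟩
        have h1 : (s * s') * (s * s') = 1 := by
          calc (s * s') * (s * s') = s * (s' * s) * s' := by group
            _ = s * (s * s') * s' := by rw [hc.eq]
            _ = (s * s) * (s' * s') := by group
            _ = 1 := by rw [hss, hs's', one_mul]
        have h2 := haa _ hu h1
        have h3 := mul_eq_one_iff_eq_inv.1 h2
        rw [inv_eq_of_mul_eq_one_left hs's'] at h3
        simpa using h3
      · obtain ⟨k, hk⟩ := hG.conj_invol s s' hss hs's' hc
        exact ⟨(s * s') ^ k, pow_mem hmem k, hu.pow_left k, hk⟩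
    refine ⟨y, hyK, ?_⟩
    apply conjugate_eq_of_le
    have hCy : ∀ c ∈ H, Commute c a → g⁻¹ * c * g ∈ H.conjugate y := by
      intro c hc hca
      have hcy : Commute y c := hG.ca a _ _ ha1 hya hca
      have key : ∀ d ∈ H, Commute y d → d ∈ H.conjugate y := by
        intro d hd hyd
        rw [mem_conjugate, hyd.eq]; simpa using hd
      rcases hC c hca with h | h
      · rw [h]; exact key c hc hcy
      · rw [h]; exact key _ (inv_mem hc) hcy.inv_right
    intro z hz
    rw [mem_conjugate] at hz
    obtain ⟨h, hh⟩ : ∃ h, h = g * z * g⁻¹ := ⟨_, rfl⟩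
    rw [← hh] at hz
    have hz' : z = g⁻¹ * h * g := by rw [hh]; group
    by_cases hca : Commute h a
    · rw [hz']; exact hCy h hz hca
    · have h1 := hCy (s * h) (mul_mem hs hz) (hmul s h hsinv (hnc h hz hca))
      have h2 : s' ∈ H.conjugate y := by rw [← hys]; exact conj_mem_conjugate H y s hs
      have h3 : z = s' * (g⁻¹ * (s * h) * g) := by
        rw [hz', hs']
        calc g⁻¹ * h * g = g⁻¹ * (1 * h) * g := by group
          _ = g⁻¹ * ((s * s) * h) * g := by rw [hss]
          _ = _ := by group
      rw [h3]
      exact mul_mem h2 h1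

theorem dih (hG : Good n G) (H : Subgroup G) (a : G) (ha : a ∈ H) (ha1 : a ≠ 1)
    (hodd : Odd (orderOf a)) (hinv : ∀ h ∈ H, h * a * h⁻¹ = a ∨ h * a * h⁻¹ = a⁻¹) :
    IsPronormal H := by
  obtain ⟨r, hr, hrd⟩ := Nat.exists_prime_and_dvd (fun h => ha1 (orderOf_eq_one_iff.1 h))
  have : Fact r.Prime := ⟨hr⟩
  obtain ⟨m, hm⟩ := hrd
  obtain ⟨b, hb⟩ : ∃ b, b = a ^ m := ⟨_, rfl⟩
  have hbr : orderOf b = r := by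
    have h0 := orderOf_pos a
    have hm0 : m ≠ 0 := by rintro rfl; omega
    rw [hb, orderOf_pow_of_dvd hm0 ⟨r, by rw [hm, mul_comm]⟩, hm,
      Nat.mul_div_cancel _ (Nat.pos_of_ne_zero hm0)]
  have hbH : b ∈ H := hb ▸ pow_mem ha m
  have hb1 : b ≠ 1 := by
    rintro rfl
    rw [orderOf_one] at hbr
    exact hr.one_lt.ne hbr
  have hbodd : Odd (orderOf b) := by
    rw [hbr]; exact hodd.of_dvd_nat ⟨m, hm⟩
  have hbinv : ∀ h ∈ H, h * b * h⁻¹ = b ∨ h * b * h⁻¹ = b⁻¹ := by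
    intro h hh
    rw [hb, ← conj_pow]
    rcases hinv h hh with h1 | h1
    · left; rw [h1]
    · right; rw [h1, inv_pow]
  intro g
  obtain ⟨K, hK⟩ : ∃ K, K = H ⊔ H.conjugate g := ⟨_, rfl⟩
  have hbK : b ∈ K := hK ▸ (le_sup_left : H ≤ _) hbH
  have hcK : g⁻¹ * b * g ∈ K :=
    hK ▸ (le_sup_right : _ ≤ H ⊔ H.conjugate g) (conj_mem_conjugate H g b hbH)
  have hpg : ∀ z : K, (z : G) ^ r = 1 → IsPGroup r (Subgroup.zpowers z) := by
    intro z hz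
    have h1 : z ^ r = 1 := by ext; simpa using hz
    rintro ⟨w, k, rfl⟩
    refine ⟨1, ?_⟩
    ext
    simp only [pow_one]
    show (((z ^ k) ^ r : K) : G) = 1
    rw [← zpow_natCast, ← zpow_mul, mul_comm, zpow_mul, zpow_natCast, h1]; simp
  obtain ⟨P1, hP1⟩ := (hpg ⟨b, hbK⟩ (by rw [← hbr]; exact pow_orderOf_eq_one b)).exists_le_sylow
  obtain ⟨P2, hP2⟩ := (hpg ⟨g⁻¹ * b * g, hcK⟩ (by
    have := conj_pow (a := g⁻¹) (b := b) (i := r)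
    rw [inv_inv] at this
    show (g⁻¹ * b * g) ^ r = 1
    rw [this, ← hbr, pow_orderOf_eq_one]; simp)).exists_le_sylow
  obtain ⟨x, hx⟩ := MulAction.exists_smul_eq K P1 P2
  have h1 : x * ⟨b, hbK⟩ * x⁻¹ ∈ P2 := by
    rw [← hx]
    exact ⟨_, hP1 (Subgroup.mem_zpowers _), rfl⟩
  have h2 : (⟨g⁻¹ * b * g, hcK⟩ : K) ∈ P2 := hP2 (Subgroup.mem_zpowers _)
  have hPg : IsPGroup r ((P2 : Subgroup K).map K.subtype) := P2.isPGroup'.map _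
  have hcomm : Commute (g⁻¹ * b * g) ((x : G) * b * (x : G)⁻¹) :=
    hG.pgroup_comm r _ hPg _ _ ⟨_, h2, rfl⟩ ⟨_, h1, rfl⟩
  obtain ⟨b', hb'⟩ : ∃ b', b' = (x : G) * b * (x : G)⁻¹ := ⟨_, rfl⟩
  have hbb : b = (x : G)⁻¹ * b' * x := by rw [hb']; group
  have hb'odd : Odd (orderOf b') := by
    have : b' = MulAut.conj (x : G) b := by rw [hb']; simp
    rw [this]; rw [MulEquiv.orderOf_eq]; exact hbodd
  have hcc : g⁻¹ * b * g = (g⁻¹ * (x : G)⁻¹) * b' * (g⁻¹ * (x : G)⁻¹)⁻¹ := by rw [hbb]; group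
  have h3 := hG.fus' b' (g⁻¹ * (x : G)⁻¹) hb'odd (by rw [← hcc, hb']; exact hcomm)
  rw [← hcc] at h3
  have hxK : (x : G) ∈ H ⊔ H.conjugate g := hK ▸ x.2
  obtain ⟨y, hy, hyy⟩ := hG.dih_core H b hb1 hbodd hbinv (g * x) (by
    have : (g * (x : G))⁻¹ * b * (g * x) = (x : G)⁻¹ * (g⁻¹ * b * g) * x := by group
    rw [this, hbb]
    rw [hbb] at h3
    rcases h3 with h3 | h3
    · left; rw [h3]
    · right; rw [h3]; group)
  refine ⟨y * (x : G)⁻¹, mul_mem (conj_le_sup H g x hxK hy) (inv_mem hxK), ?_⟩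
  rw [conjugate_mul, hyy, ← conjugate_mul]; simp

theorem big (hG : Good n G) (H : Subgroup G) (x : G) (hx1 : x ≠ 1) (hx : x * x = 1)
    (hH : ∀ c, Commute c x → c ∈ H) : IsPronormal H := by
  have hci : ∀ g : G, (g⁻¹ * x * g) * (g⁻¹ * x * g) = 1 := by
    intro g
    calc (g⁻¹ * x * g) * (g⁻¹ * x * g) = g⁻¹ * (x * x) * g := by group
      _ = 1 := by rw [hx]; group
  have hcc : ∀ g c : G, Commute c (g⁻¹ * x * g) → c ∈ H.conjugate g := by
    intro g c hc
    rw [mem_conjugate]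
    apply hH
    have := hc.map (MulAut.conj g)
    simpa [mul_assoc] using this
  intro g
  by_cases hg : Commute x (g⁻¹ * x * g)
  · by_cases hall : ∀ h ∈ H, Commute x (h⁻¹ * x * h)
    · refine ⟨1, one_mem _, ?_⟩
      apply conjugate_eq_of_le
      rw [conjugate_one]
      intro y hy
      rw [mem_conjugate] at hy
      obtain ⟨h, hh⟩ : ∃ h, h = g * y * g⁻¹ := ⟨_, rfl⟩
      rw [← hh] at hy
      have hyh : y = g⁻¹ * h * g := by rw [hh]; group
      have hflip : ∀ k : G, Commute x (k⁻¹ * x * k) → Commute (k * x * k⁻¹) x := by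
        intro k hk
        have := hk.map (MulAut.conj k)
        simpa [mul_assoc] using this
      have ht := hG.tor x g h hx1 hx (hflip g hg) (hflip h (hall h hy))
      have hc : (h⁻¹ * y) ∈ H := by
        apply hH
        have : (h⁻¹ * y) * x * (h⁻¹ * y)⁻¹ = x := by
          calc (h⁻¹ * y) * x * (h⁻¹ * y)⁻¹
              = (g * h)⁻¹ * ((h * g) * x * (h * g)⁻¹) * (g * h) := by rw [hyh]; group
            _ = x := by rw [← ht]; group
        exact mul_inv_eq_iff_eq_mul.1 this
      have := mul_mem hy hc
      simpa using this
    · push Not at hall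
      obtain ⟨h, hh, hc⟩ := hall
      have : H = ⊤ := by
        refine hG.gen x _ hx (hci h) hc H hH ?_
        intro c hc
        have := hcc h c hc
        rw [mem_conjugate] at this
        have := mul_mem (mul_mem (inv_mem hh) this) hh
        simpa [mul_assoc] using this
      exact ⟨g, by rw [this]; simp, rfl⟩
  · have : H ⊔ H.conjugate g = ⊤ := by
      refine hG.gen x _ hx (hci g) hg _ ?_ ?_
      · intro c hc
        exact (le_sup_left : H ≤ _) (hH c hc)
      · intro c hc
        exact (le_sup_right : _ ≤ H ⊔ H.conjugate g) (hcc g c hc)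
    exact ⟨g, by rw [this]; trivial, rfl⟩

end Good

theorem elem_iso {H : Type*} [Group H] [Finite H] (h : ∀ x : H, x * x = 1) (j : ℕ)
    (hj : Nat.card H = 2 ^ j) : Nonempty (H ≃* (Fin j → Multiplicative (ZMod 2))) := by
  letI : CommGroup H := { (inferInstance : Group H) with
    mul_comm := by
      intro a b
      have ha : ∀ x : H, x⁻¹ = x := fun x => inv_eq_of_mul_eq_one_left (h x)
      have := ha (a * b)
      rw [mul_inv_rev, ha, ha] at this
      exact this.symm }
  have h2 : ∀ x : Additive H, 2 • x = 0 := by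
    intro x
    rw [two_nsmul]
    exact h x.toMul
  letI : Module (ZMod 2) (Additive H) := AddCommGroup.zmodModule h2
  have : Finite (Additive H) := inferInstanceAs (Finite H)
  have : Module.Finite (ZMod 2) (Additive H) := inferInstance
  have hfr : Module.finrank (ZMod 2) (Additive H) = j := by
    have := Module.natCard_eq_pow_finrank (K := ZMod 2) (V := Additive H)
    rw [show Nat.card (Additive H) = Nat.card H from rfl, hj, Nat.card_zmod] at this
    exact (Nat.pow_right_injective le_rfl this).symm
  let e := (Module.finBasisOfFinrankEq (ZMod 2) (Additive H) hfr).equivFun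
  exact ⟨{ toFun := fun x i => Multiplicative.ofAdd (e (Additive.ofMul x) i)
           invFun := fun f => (e.symm (fun i => (f i).toAdd)).toMul
           left_inv := fun x => by simp
           right_inv := fun f => by funext i; simp
           map_mul' := fun x y => by funext i; simp }⟩

namespace Good

variable {n : ℕ} {G : Type*} [Group G] [Finite G]

theorem sq_of_two (hG : Good n G) (P : Subgroup G) (hP : IsPGroup 2 P) (a : G) (ha : a ∈ P) :
    a * a = 1 := by
  rcases hG.even_or_odd a with h | h
  · exact h
  · obtain ⟨k, hk⟩ := hP ⟨a, ha⟩
    have hk' : a ^ 2 ^ k = 1 := by simpa using congrArg Subtype.val hk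
    have h1 := Nat.dvd_gcd (orderOf_dvd_of_pow_eq_one hk') dvd_rfl
    rw [((Nat.coprime_two_left.2 h).pow_left k : Nat.gcd (2 ^ k) _ = 1)] at h1
    rw [orderOf_eq_one_iff.1 (Nat.dvd_one.1 h1), one_mul]

theorem forward (hG : Good n G) (H : Subgroup G) (hH : IsPronormal H) (j : ℕ) (h1 : 1 ≤ j)
    (hjn : j < n) (e : H ≃* (Fin j → Multiplicative (ZMod 2))) : False := by
  have hcard : Nat.card H = 2 ^ j := by
    rw [Nat.card_congr e.toEquiv, Nat.card_pi]
    simp [show Nat.card (Multiplicative (ZMod 2)) = 2 from Nat.card_zmod 2]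
  have hP : IsPGroup 2 H := IsPGroup.of_card hcard
  have hn : Nontrivial H := by
    rw [← Finite.one_lt_card_iff_nontrivial, hcard]
    exact Nat.one_lt_two_pow (by omega)
  obtain ⟨⟨x, hxH⟩, hx1'⟩ := exists_ne (1 : H)
  have hx1 : x ≠ 1 := fun h => hx1' (by ext; exact h)
  have hx := hG.sq_of_two H hP x hxH
  have hle : H ≤ Subgroup.centralizer {x} := by
    intro a ha
    rw [Subgroup.mem_centralizer_singleton_iff]
    exact hG.pgroup_comm 2 H hP a x ha hxH
  obtain ⟨w, hw, hwH⟩ : ∃ w ∈ Subgroup.centralizer {x}, w ∉ H := by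
    by_contra hcon
    push Not at hcon
    have : Subgroup.centralizer {x} = H := le_antisymm hcon hle
    have h2 := hG.card x hx1 hx
    rw [this, hcard] at h2
    have := Nat.pow_right_injective le_rfl h2
    omega
  rw [Subgroup.mem_centralizer_singleton_iff] at hw
  have hwx : Commute w x := hw
  have hw1 : w ≠ 1 := fun h => hwH (h ▸ one_mem H)
  have hww : w * w = 1 := hG.inv x w hx1 hx hwx
  obtain ⟨y, hy, hxy⟩ := hG.ex x hx1 hx
  have hyw : ¬ Commute y w := fun h => hxy (hG.ca w x y hw1 hwx.symm h)
  obtain ⟨k, hk⟩ := hG.conj_invol x y hx hy hxy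
  obtain ⟨l, hl⟩ := hG.conj_invol y w hy hww hyw
  obtain ⟨g, hg⟩ : ∃ g, g⁻¹ * x * g = w := by
    refine ⟨(x * y) ^ k * (y * w) ^ l, ?_⟩
    calc ((x * y) ^ k * (y * w) ^ l)⁻¹ * x * ((x * y) ^ k * (y * w) ^ l)
        = ((y * w) ^ l)⁻¹ * (((x * y) ^ k)⁻¹ * x * (x * y) ^ k) * (y * w) ^ l := by
          simp only [mul_inv_rev, mul_assoc]
      _ = w := by rw [hk, hl]
  have hw2 : w ∈ H.conjugate g := by rw [← hg]; exact conj_mem_conjugate H g x hxH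
  obtain ⟨z, hz, hzg⟩ := hH g
  have hcx : H ⊔ H.conjugate g ≤ Subgroup.centralizer {x} := by
    refine sup_le hle ?_
    intro c hc
    rw [mem_conjugate] at hc
    have h3 : Commute (g * c * g⁻¹) x := hG.pgroup_comm 2 H hP _ x hc hxH
    have h4 : Commute c w := by
      have := h3.map (MulAut.conj g⁻¹)
      rw [← hg]
      simpa [mul_assoc] using this
    rw [Subgroup.mem_centralizer_singleton_iff]
    exact hG.ca w c x hw1 h4 hwx.symm
  have hzx : Commute z x := by
    have := hcx hz
    rw [Subgroup.mem_centralizer_singleton_iff] at this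
    exact this
  rw [← hzg, mem_conjugate] at hw2
  apply hwH
  have : Commute z w := hG.ca x z w hx1 hzx hwx
  rw [this.eq] at hw2
  simpa using hw2

theorem two_group (hG : Good n G) (H : Subgroup G) (hH : IsPGroup 2 H) (hp : ¬ IsPronormal H) :
    ∃ j : ℕ, 1 ≤ j ∧ j < n ∧ Nonempty (H ≃* (Fin j → Multiplicative (ZMod 2))) := by
  obtain ⟨j, hj⟩ := IsPGroup.iff_card.1 hH
  have hbot : H ≠ ⊥ := by
    rintro rfl
    apply hp
    intro g
    refine ⟨1, one_mem _, ?_⟩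
    apply conjugate_eq_of_le
    rw [conjugate_one]
    intro y hy
    rw [mem_conjugate] at hy
    simpa using hy
  obtain ⟨x, hxH, hx1⟩ := (Subgroup.ne_bot_iff_exists_ne_one).1 hbot |>.elim
    fun a ha => (⟨a.1, a.2, fun h => ha (by ext; exact h)⟩ : ∃ x, x ∈ H ∧ x ≠ 1)
  have hx := hG.sq_of_two H hH x hxH
  have hle : H ≤ Subgroup.centralizer {x} := by
    intro a ha
    rw [Subgroup.mem_centralizer_singleton_iff]
    exact hG.pgroup_comm 2 H hH a x ha hxH
  refine ⟨j, ?_, ?_, elem_iso (fun a => by ext; exact hG.sq_of_two H hH a a.2) j hj⟩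
  · rcases Nat.eq_zero_or_pos j with rfl | h
    · exact absurd (Subgroup.card_eq_one.1 (by simpa using hj)) hbot
    · exact h
  · by_contra hlt
    push Not at hlt
    apply hp
    have heq : H = Subgroup.centralizer {x} := by
      apply Subgroup.eq_of_le_of_card_ge hle
      rw [hG.card x hx1 hx, hj]
      exact Nat.pow_le_pow_right (by norm_num) hlt
    apply hG.big H x hx1 hx
    intro c hc
    rw [heq, Subgroup.mem_centralizer_singleton_iff]
    exact hc

theorem not_two_group (hG : Good n G) (H : Subgroup G) (hH : ¬ IsPGroup 2 H) : IsPronormal H := by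
  obtain S : Sylow 2 H := default
  have hSg : IsPGroup 2 ((S : Subgroup H).map H.subtype) := S.isPGroup'.map _
  by_cases hS : Subgroup.normalizer (S : Set H) ≤ Subgroup.centralizer (S : Set H)
  · have hcompl := MonoidHom.ker_transferSylow_isComplement' S hS
    have hndvd := MonoidHom.not_dvd_card_ker_transferSylow S hS
    set N := (MonoidHom.transferSylow S hS).ker with hN
    have hodd : Odd (Nat.card N) := by
      rw [← Nat.not_even_iff_odd, even_iff_two_dvd]; exact hndvd
    have hord : ∀ x : H, x ∈ N → Odd (orderOf (x : G)) := by
      intro x hx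
      rw [Subgroup.orderOf_coe]
      exact hodd.of_dvd_nat (Subgroup.orderOf_dvd_natCard N hx)
    have hcoe : ∀ a b : N, Commute ((a : H) : G) ((b : H) : G) → Commute a b := by
      intro a b h
      apply Subtype.ext; apply Subtype.ext; exact h
    have hcoe' : ∀ a b : N, Commute a b → Commute ((a : H) : G) ((b : H) : G) := by
      intro a b h
      have := congrArg (fun z : N => ((z : H) : G)) h.eq
      exact this
    have hcomm : ∀ a b : N, Commute a b := by
      apply odd_comm hodd
      · intro x a b hx ha hb
        apply hcoe
        refine hG.ca ((x : H) : G) _ _ ?_ (hcoe' _ _ ha) (hcoe' _ _ hb)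
        intro h; apply hx; apply Subtype.ext; apply Subtype.ext; exact h
      · intro p h hc
        rcases hG.fus' ((p : H) : G) ((h : H) : G) (hord p p.2) (hcoe' _ _ hc) with h1 | h1
        · left; apply Subtype.ext; apply Subtype.ext; exact h1
        · right; apply Subtype.ext; apply Subtype.ext; exact h1
    have hNbot : N ≠ ⊥ := by
      intro h
      rw [h, Subgroup.isComplement'_bot_left] at hcompl
      apply hH
      have := S.isPGroup'
      rw [hcompl] at this
      exact this.of_equiv Subgroup.topEquiv
    obtain ⟨⟨a, haN⟩, ha1⟩ := (Subgroup.ne_bot_iff_exists_ne_one).1 hNbot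
    apply hG.dih H (a : G) a.2
    · intro h; apply ha1; apply Subtype.ext; apply Subtype.ext; exact h
    · exact hord a haN
    · intro h hh
      have hmem : (⟨h, hh⟩ : H) * a * (⟨h, hh⟩ : H)⁻¹ ∈ N :=
        (MonoidHom.normal_ker _).conj_mem a haN _
      exact hG.fus' (a : G) h (hord a haN) (hcoe' ⟨_, hmem⟩ ⟨a, haN⟩ (hcomm _ _))
  · obtain ⟨h, hh, hc⟩ := SetLike.not_le_iff_exists.1 hS
    rw [Subgroup.mem_centralizer_iff] at hc
    push Not at hc
    obtain ⟨s, hs, hsc⟩ := hc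
    have hs1 : (s : G) ≠ 1 := by
      intro h1
      apply hsc
      have : s = 1 := by ext; exact h1
      rw [this]; simp
    have hsS : (s : G) ∈ (S : Subgroup H).map H.subtype := ⟨s, hs, rfl⟩
    have hss := hG.sq_of_two _ hSg s hsS
    apply hG.big H s hs1 hss
    intro c hc
    have := hG.full s h hs1 hss ((S : Subgroup H).map H.subtype) hsS
      (fun t ht => hG.pgroup_comm 2 _ hSg t s ht hsS) (by
        rintro _ ⟨t, ht, rfl⟩
        exact ⟨h * t * h⁻¹, (Subgroup.mem_normalizer_iff.1 hh t).1 ht, rfl⟩)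
      (fun hcc => hsc (by ext; exact hcc.symm)) c hc
    obtain ⟨t, -, rfl⟩ := this
    exact t.2

theorem main (hG : Good n G) (H : Subgroup G) : ¬ IsPronormal H ↔
    ∃ j : ℕ, 1 ≤ j ∧ j < n ∧ Nonempty (H ≃* (Fin j → Multiplicative (ZMod 2))) := by
  constructor
  · intro h
    exact hG.two_group H (by_contra fun h2 => h (hG.not_two_group H h2)) h
  · rintro ⟨j, h1, h2, ⟨e⟩⟩ hp
    exact hG.forward H hp j h1 h2 e

end Good

theorem pronormal_of_equiv {G G' : Type*} [Group G] [Group G'] (e : G ≃* G') (H : Subgroup G)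
    (h : IsPronormal H) : IsPronormal (H.map e.toMonoidHom) := by
  have hc : ∀ g : G, (H.map e.toMonoidHom).conjugate (e g) = (H.conjugate g).map e.toMonoidHom := by
    intro g
    ext y
    obtain ⟨z, rfl⟩ := e.surjective y
    have h1 : ∀ (K : Subgroup G) (u : G), e u ∈ K.map e.toMonoidHom ↔ u ∈ K := by
      intro K u
      exact Subgroup.mem_map_iff_mem e.injective
    rw [mem_conjugate, ← map_inv, ← map_mul, ← map_mul, h1, h1, mem_conjugate]
  intro g'
  obtain ⟨g, rfl⟩ := e.surjective g'
  obtain ⟨x, hx, hxg⟩ := h g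
  refine ⟨e x, ?_, ?_⟩
  · rw [hc, ← Subgroup.map_sup]
    exact ⟨x, hx, rfl⟩
  · rw [hc, hc, hxg]

section Mat

open Matrix

variable {F : Type*} [Field F]

local notation "SL2" => Matrix.SpecialLinearGroup (Fin 2) F

theorem sl_det (A : SL2) : A 0 0 * A 1 1 - A 0 1 * A 1 0 = 1 := by
  have := A.det_coe
  rwa [Matrix.det_fin_two] at this

theorem sl_ext (A B : SL2) (h1 : A 0 0 = B 0 0) (h2 : A 0 1 = B 0 1) (h3 : A 1 0 = B 1 0)
    (h4 : A 1 1 = B 1 1) : A = B := by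
  ext i j; fin_cases i <;> fin_cases j <;> assumption

theorem sl_mk (a b c d : F) (h : a * d - b * c = 1) :
    ∃ A : SL2, A 0 0 = a ∧ A 0 1 = b ∧ A 1 0 = c ∧ A 1 1 = d :=
  ⟨⟨!![a, b; c, d], by rw [Matrix.det_fin_two_of, h]⟩, rfl, rfl, rfl, rfl⟩

theorem sl_mul (A B : SL2) :
    (A * B) 0 0 = A 0 0 * B 0 0 + A 0 1 * B 1 0 ∧ (A * B) 0 1 = A 0 0 * B 0 1 + A 0 1 * B 1 1 ∧
    (A * B) 1 0 = A 1 0 * B 0 0 + A 1 1 * B 1 0 ∧ (A * B) 1 1 = A 1 0 * B 0 1 + A 1 1 * B 1 1 := by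
  simp [Matrix.mul_apply, Fin.sum_univ_two]

theorem sl_one : (1 : SL2) 0 0 = 1 ∧ (1 : SL2) 0 1 = 0 ∧ (1 : SL2) 1 0 = 0 ∧ (1 : SL2) 1 1 = 1 := by
  simp

theorem sl_inv (A : SL2) : A⁻¹ 0 0 = A 1 1 ∧ A⁻¹ 0 1 = - A 0 1 ∧ A⁻¹ 1 0 = - A 1 0 ∧
    A⁻¹ 1 1 = A 0 0 := by
  rw [Matrix.SpecialLinearGroup.SL2_inv_expl]
  exact ⟨rfl, rfl, rfl, rfl⟩

theorem sl_commute (A B : SL2) : Commute A B ↔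
    A 0 1 * B 1 0 = B 0 1 * A 1 0 ∧ (A 0 0 - A 1 1) * B 0 1 = A 0 1 * (B 0 0 - B 1 1) ∧
    (A 0 0 - A 1 1) * B 1 0 = A 1 0 * (B 0 0 - B 1 1) := by
  obtain ⟨h1, h2, h3, h4⟩ := sl_mul A B
  obtain ⟨k1, k2, k3, k4⟩ := sl_mul B A
  constructor
  · intro h
    rw [h.eq] at h1 h2 h3 h4
    refine ⟨?_, ?_, ?_⟩
    · linear_combination k1 - h1
    · linear_combination k2 - h2
    · linear_combination h3 - k3
  · rintro ⟨e1, e2, e3⟩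
    apply sl_ext
    · rw [h1, k1]; linear_combination e1
    · rw [h2, k2]; linear_combination e2
    · rw [h3, k3]; linear_combination - e3
    · rw [h4, k4]; linear_combination - e1

variable [CharP F 2]

theorem two_zero : (2 : F) = 0 := CharTwo.two_eq_zero

theorem ch_eq (a b : F) : a - b = 0 ↔ a + b = 0 := by rw [CharTwo.sub_eq_add]

theorem sl_ne_one (A : SL2) (h : A ≠ 1) : A 0 0 - A 1 1 ≠ 0 ∨ A 0 1 ≠ 0 ∨ A 1 0 ≠ 0 := by
  by_contra hc
  push Not at hc
  obtain ⟨h1, h2, h3⟩ := hc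
  apply h
  have hd := sl_det A
  obtain ⟨o1, o2, o3, o4⟩ := sl_one (F := F)
  have h4 : A 0 0 = A 1 1 := sub_eq_zero.1 h1
  have h5 : A 1 1 = 1 := by
    rw [h4, h2] at hd
    have h6 : (A 1 1 - 1) ^ 2 = 0 := by
      linear_combination hd + (1 - A 1 1) * two_zero (F := F)
    exact sub_eq_zero.1 (pow_eq_zero_iff (two_ne_zero) |>.1 h6)
  apply sl_ext
  · rw [o1, h4, h5]
  · rw [o2, h2]
  · rw [o3, h3]
  · rw [o4, h5]

theorem sl_sq (A : SL2) : A * A = 1 ↔ A 0 0 = A 1 1 := by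
  have hd := sl_det A
  obtain ⟨h1, h2, h3, h4⟩ := sl_mul A A
  obtain ⟨o1, o2, o3, o4⟩ := sl_one (F := F)
  have h2z := two_zero (F := F)
  constructor
  · intro h
    rw [h] at h1 h2 h3 h4
    have h6 : (A 0 0 - A 1 1) ^ 2 = 0 := by
      rw [o1] at h1; rw [o4] at h4
      linear_combination - h1 - h4 - 2 * hd + (- A 0 1 * A 1 0 * 2) * h2z
    exact sub_eq_zero.1 (pow_eq_zero_iff (two_ne_zero) |>.1 h6)
  · intro h
    apply sl_ext
    · rw [h1, o1]; linear_combination hd + A 0 0 * h + A 0 1 * A 1 0 * h2z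
    · rw [h2, o2]; linear_combination A 0 1 * h + A 0 1 * A 1 1 * h2z
    · rw [h3, o3]; linear_combination A 1 0 * h + A 1 0 * A 1 1 * h2z
    · rw [h4, o4]; linear_combination hd - A 1 1 * h + A 0 1 * A 1 0 * h2z

theorem sl_ca (x a b : SL2) (hx : x ≠ 1) (ha : Commute a x) (hb : Commute b x) : Commute a b := by
  rw [sl_commute] at *
  obtain ⟨a1, a2, a3⟩ := ha
  obtain ⟨b1, b2, b3⟩ := hb
  rcases sl_ne_one x hx with h | h | h
  · refine ⟨?_, ?_, ?_⟩ <;> apply mul_left_cancel₀ h <;> grind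
  · refine ⟨?_, ?_, ?_⟩ <;> apply mul_left_cancel₀ h <;> grind
  · refine ⟨?_, ?_, ?_⟩ <;> apply mul_left_cancel₀ h <;> grind

theorem sl_invol (x c : SL2) (hx1 : x ≠ 1) (hx : x * x = 1) (hc : Commute c x) : c * c = 1 := by
  rw [sl_sq] at *
  rw [sl_commute] at hc
  obtain ⟨a1, a2, a3⟩ := hc
  rw [hx, sub_self, mul_zero] at a2 a3
  rcases sl_ne_one x hx1 with h | h | h
  · exact absurd (sub_eq_zero.2 hx) h
  · exact sub_eq_zero.1 ((mul_eq_zero.1 a2).resolve_right h)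
  · exact sub_eq_zero.1 ((mul_eq_zero.1 a3).resolve_right h)

theorem sl_fus (x p : SL2) (ht : x 0 0 + x 1 1 = p 0 0 + p 1 1) (hc : Commute x p) :
    (x⁻¹ * p) ^ 2 = 1 ∨ (x * p) ^ 2 = 1 := by
  rw [pow_two, pow_two, sl_sq, sl_sq]
  rw [sl_commute] at hc
  obtain ⟨a1, a2, a3⟩ := hc
  obtain ⟨h1, h2, h3, h4⟩ := sl_mul x⁻¹ p
  obtain ⟨k1, k2, k3, k4⟩ := sl_mul x p
  obtain ⟨i1, i2, i3, i4⟩ := sl_inv x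
  have hdx := sl_det x
  have hdp := sl_det p
  have h2z := two_zero (F := F)
  rw [h1, h4, k1, k4, i1, i2, i3, i4]
  generalize x 0 0 = a at *
  generalize x 0 1 = b at *
  generalize x 1 0 = c at *
  generalize x 1 1 = d at *
  generalize p 0 0 = p' at *
  generalize p 0 1 = q at *
  generalize p 1 0 = r at *
  generalize p 1 1 = s at *
  clear h1 h2 h3 h4 k1 k2 k3 k4 i1 i2 i3 i4
  have e1 : a - d = p' - s := by linear_combination ht + (s - d) * h2z
  by_cases hz : p' - s = 0
  · right
    have hps : p' = s := sub_eq_zero.1 hz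
    have had : a = d := sub_eq_zero.1 (e1.trans hz)
    rw [hps, had]; linear_combination a1
  · have hb : b = q := by
      apply mul_left_cancel₀ hz; rw [e1] at a2; linear_combination - a2
    have hcr : c = r := by
      apply mul_left_cancel₀ hz; rw [e1] at a3; linear_combination - a3
    have hprod : (a - p') * (a - s) = 0 := by
      rw [hb, hcr] at hdx
      linear_combination hdp - hdx + a * ht
    rcases mul_eq_zero.1 hprod with h | h
    · left
      have hap : a = p' := sub_eq_zero.1 h
      have hds : d = s := by linear_combination ht - h
      rw [hap, hds, hb, hcr]; ring
    · right
      have hap : a = s := sub_eq_zero.1 h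
      have hds : d = p' := by linear_combination ht - h
      rw [hap, hds, hb, hcr]; ring

theorem sl_trace_conj (p h : SL2) :
    (h * p * h⁻¹) 0 0 + (h * p * h⁻¹) 1 1 = p 0 0 + p 1 1 := by
  obtain ⟨h1, h2, h3, h4⟩ := sl_mul (h * p) h⁻¹
  obtain ⟨k1, k2, k3, k4⟩ := sl_mul h p
  obtain ⟨i1, i2, i3, i4⟩ := sl_inv h
  rw [h1, h4, k1, k2, k3, k4, i1, i2, i3, i4]
  linear_combination (p 0 0 + p 1 1) * sl_det h

theorem sl_ex (x : SL2) (hx1 : x ≠ 1) (hx : x * x = 1) : ∃ y : SL2, y * y = 1 ∧ ¬ Commute x y := by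
  obtain ⟨u, u1, u2, u3, u4⟩ := sl_mk (F := F) 1 1 0 1 (by ring)
  obtain ⟨l, l1, l2, l3, l4⟩ := sl_mk (F := F) 1 0 1 1 (by ring)
  have hu : u * u = 1 := by rw [sl_sq, u1, u4]
  have hl : l * l = 1 := by rw [sl_sq, l1, l4]
  by_cases h : Commute x u
  · refine ⟨l, hl, fun h' => ?_⟩
    have := sl_ca x u l hx1 h.symm h'.symm
    rw [sl_commute] at this
    simp [u2, l3, l2] at this
  · exact ⟨u, hu, h⟩

/-- The one-parameter unipotent group through an involution. -/
theorem sl_U (x : SL2) (hx : x * x = 1) :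
    ∃ U : F → SL2, ∀ β, (U β : Matrix (Fin 2) (Fin 2) F) =
      (1 + β) • (1 : Matrix (Fin 2) (Fin 2) F) + β • (x : Matrix (Fin 2) (Fin 2) F) := by
  rw [sl_sq] at hx
  have hd := sl_det x
  refine ⟨fun β => ⟨(1 + β) • (1 : Matrix (Fin 2) (Fin 2) F) +
    β • (x : Matrix (Fin 2) (Fin 2) F), ?_⟩, fun β => rfl⟩
  rw [Matrix.det_fin_two]
  simp
  rw [← hx] at hd ⊢
  linear_combination β ^ 2 * hd + (β + β ^ 2 + (β + β ^ 2) * x 0 0) * two_zero (F := F)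

theorem sl_U_entries (x : SL2) (U : F → SL2) (hU : ∀ β, (U β : Matrix (Fin 2) (Fin 2) F) =
      (1 + β) • (1 : Matrix (Fin 2) (Fin 2) F) + β • (x : Matrix (Fin 2) (Fin 2) F)) (β : F) :
    U β 0 0 = 1 + β + β * x 0 0 ∧ U β 0 1 = β * x 0 1 ∧ U β 1 0 = β * x 1 0 ∧
    U β 1 1 = 1 + β + β * x 1 1 := by
  have h : ∀ i j, U β i j = ((1 + β) • (1 : Matrix (Fin 2) (Fin 2) F) +
    β • (x : Matrix (Fin 2) (Fin 2) F)) i j := fun i j => by rw [← hU]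
  rw [h, h, h, h]
  simp

theorem sl_U_surj (x : SL2) (hx1 : x ≠ 1) (hx : x * x = 1) (U : F → SL2)
    (hU : ∀ β, (U β : Matrix (Fin 2) (Fin 2) F) =
      (1 + β) • (1 : Matrix (Fin 2) (Fin 2) F) + β • (x : Matrix (Fin 2) (Fin 2) F))
    (c : SL2) (hc : Commute c x) : ∃ β, c = U β := by
  have hcc := sl_invol x c hx1 hx hc
  rw [sl_sq] at hx hcc
  rw [sl_commute] at hc
  obtain ⟨a1, a2, a3⟩ := hc
  have hd := sl_det x
  have hdc := sl_det c
  have h2z := two_zero (F := F)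
  have key : ∀ β, c 0 1 = β * x 0 1 → c 1 0 = β * x 1 0 → c = U β := by
    intro β h1 h2
    obtain ⟨e1, e2, e3, e4⟩ := sl_U_entries x U hU β
    have h3 : c 0 0 = 1 + β + β * x 0 0 := by
      have : (c 0 0 - (1 + β + β * x 0 0)) ^ 2 = 0 := by
        rw [h1, h2, ← hcc] at hdc
        rw [← hx] at hd
        linear_combination hdc - β ^ 2 * hd + (- c 0 0 * (1 + β + β * x 0 0) + 1 + β + β ^ 2 + β ^ 2 * x 0 0 ^ 2 + (β + β ^ 2) * x 0 0 - β ^ 2) * h2z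
      exact sub_eq_zero.1 (pow_eq_zero_iff (two_ne_zero) |>.1 this)
    apply sl_ext
    · rw [e1, h3]
    · rw [e2, h1]
    · rw [e3, h2]
    · rw [e4, ← hcc, ← hx, h3]
  rcases sl_ne_one x hx1 with h | h | h
  · exact absurd (sub_eq_zero.2 hx) h
  · refine ⟨c 0 1 / x 0 1, key _ (by field_simp) ?_⟩
    field_simp; linear_combination - a1
  · refine ⟨c 1 0 / x 1 0, key _ ?_ (by field_simp)⟩
    field_simp; linear_combination a1

theorem sl_U_inj (x : SL2) (hx1 : x ≠ 1) (hx : x * x = 1) (U : F → SL2)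
    (hU : ∀ β, (U β : Matrix (Fin 2) (Fin 2) F) =
      (1 + β) • (1 : Matrix (Fin 2) (Fin 2) F) + β • (x : Matrix (Fin 2) (Fin 2) F)) :
    Function.Injective U := by
  intro β γ h
  obtain ⟨e1, e2, e3, e4⟩ := sl_U_entries x U hU β
  obtain ⟨f1, f2, f3, f4⟩ := sl_U_entries x U hU γ
  rw [h] at e1 e2 e3 e4
  rw [sl_sq] at hx
  rcases sl_ne_one x hx1 with h | h | h
  · exact absurd (sub_eq_zero.2 hx) h
  · exact mul_right_cancel₀ h (e2.symm.trans f2)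
  · exact mul_right_cancel₀ h (e3.symm.trans f3)

theorem sl_U_comm (x : SL2) (U : F → SL2)
    (hU : ∀ β, (U β : Matrix (Fin 2) (Fin 2) F) =
      (1 + β) • (1 : Matrix (Fin 2) (Fin 2) F) + β • (x : Matrix (Fin 2) (Fin 2) F)) (β : F) :
    Commute (U β) x := by
  apply Subtype.ext
  rw [Matrix.SpecialLinearGroup.coe_mul, Matrix.SpecialLinearGroup.coe_mul, hU]
  simp [add_mul, mul_add]

theorem sl_U_conj (x : SL2) (U : F → SL2)
    (hU : ∀ β, (U β : Matrix (Fin 2) (Fin 2) F) =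
      (1 + β) • (1 : Matrix (Fin 2) (Fin 2) F) + β • (x : Matrix (Fin 2) (Fin 2) F)) (g : SL2)
    (μ β : F) (hg : g * x * g⁻¹ = U μ) : g * U β * g⁻¹ = U (β * μ) := by
  have h1 : (g : Matrix (Fin 2) (Fin 2) F) * x * (g⁻¹ : SL2) = U μ := by
    rw [← hg]; rfl
  have h2 : (g : Matrix (Fin 2) (Fin 2) F) * (g⁻¹ : SL2) = 1 := by
    rw [← Matrix.SpecialLinearGroup.coe_mul, mul_inv_cancel]; rfl
  apply Subtype.ext
  rw [Matrix.SpecialLinearGroup.coe_mul, Matrix.SpecialLinearGroup.coe_mul, hU, hU]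
  rw [mul_add, add_mul, mul_smul_comm, mul_smul_comm, smul_mul_assoc, smul_mul_assoc, h1, mul_one,
    h2, hU, smul_add, smul_smul, smul_smul, ← add_assoc, ← add_smul]
  congr 2
  linear_combination β * two_zero (F := F)

theorem sl_U_add (x : SL2) (hx : x * x = 1) (U : F → SL2)
    (hU : ∀ β, (U β : Matrix (Fin 2) (Fin 2) F) =
      (1 + β) • (1 : Matrix (Fin 2) (Fin 2) F) + β • (x : Matrix (Fin 2) (Fin 2) F)) (β γ : F) :
    U (β + γ) = U β * U γ := by
  have h1 : (x : Matrix (Fin 2) (Fin 2) F) * x = 1 := by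
    rw [← Matrix.SpecialLinearGroup.coe_mul, hx]; rfl
  apply Subtype.ext
  rw [Matrix.SpecialLinearGroup.coe_mul, hU, hU, hU]
  simp only [mul_add, add_mul, mul_smul_comm, smul_mul_assoc, h1, mul_one, one_mul, smul_smul]
  have h2z := two_zero (F := F)
  match_scalars
  · linear_combination (- γ * β) * h2z
  · linear_combination (- γ * β) * h2z

end Mat

section Mat2

open Matrix

variable {F : Type*} [Field F] [CharP F 2]

local notation "SL2" => Matrix.SpecialLinearGroup (Fin 2) F

theorem sl_commute_invol (A B : SL2) (hA : A * A = 1) (hB : B * B = 1) :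
    Commute A B ↔ A 0 1 * B 1 0 = B 0 1 * A 1 0 := by
  rw [sl_sq] at hA hB
  rw [sl_commute, hA, hB]
  simp

theorem sl_two_invol (hsq : ∀ a : F, ∃ b, b * b = a) (g : SL2) :
    ∃ u v : SL2, u * u = 1 ∧ v * v = 1 ∧ g = u * v := by
  have h2z := two_zero (F := F)
  obtain ⟨p, q, r, h1, h2⟩ : ∃ p q r : F, p * p + q * r = 1 ∧
      p * (g 0 0 + g 1 1) + q * g 1 0 + r * g 0 1 = 0 := by
    obtain ⟨p, q, r, h1, h2⟩ : ∃ p q r : F, p * p + q * r ≠ 0 ∧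
      p * (g 0 0 + g 1 1) + q * g 1 0 + r * g 0 1 = 0 := by
      by_cases hb : g 0 1 = 0
      · by_cases hc : g 1 0 = 0
        · exact ⟨0, 1, 1, by simp, by rw [hb, hc]; ring⟩
        · refine ⟨1, - (g 0 0 + g 1 1) / g 1 0, 0, by simp, ?_⟩
          field_simp; ring
      · refine ⟨1, 0, - (g 0 0 + g 1 1) / g 0 1, by simp, ?_⟩
        field_simp; ring
    obtain ⟨s, hs⟩ := hsq (p * p + q * r)
    have hs0 : s ≠ 0 := by rintro rfl; apply h1; rw [← hs]; ring
    refine ⟨p / s, q / s, r / s, ?_, ?_⟩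
    · field_simp; rw [pow_two, pow_two, hs]
    · field_simp; linear_combination h2
  obtain ⟨u, u1, u2, u3, u4⟩ := sl_mk (F := F) p q r p
    (by linear_combination h1 - q * r * h2z)
  have hu : u * u = 1 := by rw [sl_sq, u1, u4]
  refine ⟨u, u * g, hu, ?_, by rw [← mul_assoc, hu, one_mul]⟩
  obtain ⟨k1, k2, k3, k4⟩ := sl_mul u g
  rw [sl_sq, k1, k4, u1, u2, u3, u4]
  linear_combination h2 - (r * g 0 1 + p * g 1 1) * h2z

theorem sl_gen (hsq : ∀ a : F, ∃ b, b * b = a) (x y : SL2) (hx : x * x = 1) (hy : y * y = 1)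
    (hxy : ¬ Commute x y) (K : Subgroup SL2) (hKx : ∀ c, Commute c x → c ∈ K)
    (hKy : ∀ c, Commute c y → c ∈ K) : K = ⊤ := by
  have h2z := two_zero (F := F)
  have hinv : ∀ z : SL2, z * z = 1 → z ∈ K := by
    intro z hz
    by_cases hzx : Commute z x
    · exact hKx z hzx
    obtain ⟨U, hU⟩ := sl_U x hx
    have hc0 : x 0 1 * y 1 0 + y 0 1 * x 1 0 ≠ 0 := by
      intro h; apply hxy; rw [sl_commute_invol x y hx hy]
      linear_combination h - y 0 1 * x 1 0 * h2z
    have hd0 : z 0 1 * x 1 0 + x 0 1 * z 1 0 ≠ 0 := by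
      intro h; apply hzx; rw [sl_commute_invol z x hz hx]
      linear_combination h - x 0 1 * z 1 0 * h2z
    obtain ⟨b, hb⟩ := hsq ((y 0 1 * z 1 0 + z 0 1 * y 1 0) /
      ((x 0 1 * y 1 0 + y 0 1 * x 1 0) * (z 0 1 * x 1 0 + x 0 1 * z 1 0)))
    rw [eq_div_iff (mul_ne_zero hc0 hd0)] at hb
    have hs : U b ∈ K := hKx _ (sl_U_comm x U hU b)
    have hsy : (U b * y * (U b)⁻¹) * (U b * y * (U b)⁻¹) = 1 := by
      calc (U b * y * (U b)⁻¹) * (U b * y * (U b)⁻¹) = U b * (y * y) * (U b)⁻¹ := by group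
        _ = 1 := by rw [hy]; group
    have hcz : Commute z (U b * y * (U b)⁻¹) := by
      rw [sl_commute_invol _ _ hz hsy]
      obtain ⟨h1, h2, h3, h4⟩ := sl_mul (U b * y) (U b)⁻¹
      obtain ⟨k1, k2, k3, k4⟩ := sl_mul (U b) y
      obtain ⟨i1, i2, i3, i4⟩ := sl_inv (U b)
      obtain ⟨e1, e2, e3, e4⟩ := sl_U_entries x U hU b
      rw [h2, h3, k1, k2, k3, k4, i1, i2, i3, i4, e1, e2, e3, e4]
      rw [sl_sq] at hx hy hz
      have dx := sl_det x
      have dy := sl_det y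
      rw [← hx] at dx ⊢
      rw [← hy] at dy ⊢
      generalize x 0 0 = p at *
      generalize x 0 1 = q at *
      generalize x 1 0 = r at *
      generalize y 0 0 = p1 at *
      generalize y 0 1 = q1 at *
      generalize y 1 0 = r1 at *
      generalize z 0 1 = q2 at *
      generalize z 1 0 = r2 at *
      clear h1 h2 h3 h4 k1 k2 k3 k4 i1 i2 i3 i4 e1 e2 e3 e4 hs hsy hKx hKy hxy hzx hd0 hc0 hU U
      have hp : p * p = 1 + q * r := by linear_combination dx
      linear_combination hb + b ^ 2 * (q2 * r1 - q1 * r2) * hp + (q2 * r1 - b ^ 2 * q * r * q1 * r2 - b ^ 2 * r ^ 2 * q1 * q2 + (b ^ 2 + b + b * p + b ^ 2 * p) * (q2 * r1 - q1 * r2)) * h2z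
    have := hKy ((U b)⁻¹ * z * U b) (by
      have := hcz.map (MulAut.conj (U b)⁻¹)
      simpa [mul_assoc] using this)
    have := mul_mem (mul_mem hs this) (inv_mem hs)
    simpa [mul_assoc] using this
  rw [eq_top_iff]
  intro g _
  obtain ⟨u, v, hu, hv, rfl⟩ := sl_two_invol hsq g
  exact mul_mem (hinv u hu) (hinv v hv)

theorem sl_full (n : ℕ) (hn : n.Prime) [Fintype F] (hF : Fintype.card F = 2 ^ n)
    (x h : SL2) (hx1 : x ≠ 1) (hx : x * x = 1) (S : Subgroup SL2) (hxS : x ∈ S)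
    (hSx : ∀ s ∈ S, Commute s x) (hh : ∀ s ∈ S, h * s * h⁻¹ ∈ S) (hhx : ¬ Commute h x)
    (c : SL2) (hc : Commute c x) : c ∈ S := by
  obtain ⟨U, hU⟩ := sl_U x hx
  obtain ⟨μ, hμ⟩ := sl_U_surj x hx1 hx U hU _ (hSx _ (hh x hxS))
  have hU1 : U 1 = x := by
    apply Subtype.ext
    rw [hU, one_smul, one_add_one_eq_two, two_zero, zero_smul, zero_add]
  have hU0 : U 0 = 1 := by
    apply Subtype.ext
    rw [hU, zero_smul, add_zero, add_zero, one_smul]; rfl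
  let _ : Algebra (ZMod 2) F := ZMod.algebra F 2
  have hfr : (Module.finrank (ZMod 2) F).Prime := by
    have := Module.card_eq_pow_finrank (K := ZMod 2) (V := F)
    rw [hF, ZMod.card] at this
    rw [← Nat.pow_right_injective le_rfl this]; exact hn
  have hadd : ∀ a b, U a ∈ S → U b ∈ S → U (a + b) ∈ S := by
    intro a b ha hb
    rw [sl_U_add x hx U hU]; exact mul_mem ha hb
  let W : Subalgebra (ZMod 2) F :=
    { carrier := {m | ∀ β, U β ∈ S → U (β * m) ∈ S}
      mul_mem' := by
        intro a b ha hb β hβ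
        rw [← mul_assoc]; exact hb _ (ha _ hβ)
      add_mem' := by
        intro a b ha hb β hβ
        rw [mul_add]; exact hadd _ _ (ha _ hβ) (hb _ hβ)
      algebraMap_mem' := by
        intro r β hβ
        fin_cases r
        · show U (β * algebraMap (ZMod 2) F 0) ∈ S
          rw [map_zero, mul_zero, hU0]; exact one_mem S
        · show U (β * algebraMap (ZMod 2) F 1) ∈ S
          rw [map_one, mul_one]; exact hβ }
  have hμW : μ ∈ W := by
    intro β hβ
    rw [← sl_U_conj x U hU h μ β hμ]
    exact hh _ hβ
  have hW : W = ⊤ := by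
    have := Subalgebra.isSimpleOrder_of_finrank_prime (ZMod 2) F hfr
    rcases eq_bot_or_eq_top W with h1 | h1
    · exfalso
      rw [h1, Algebra.mem_bot] at hμW
      obtain ⟨r, hr⟩ := hμW
      fin_cases r
      · have h3 : μ = 0 := by rw [← hr]; exact map_zero _
        rw [h3, hU0, mul_inv_eq_one] at hμ
        apply hx1
        simpa using hμ
      · have h3 : μ = 1 := by rw [← hr]; exact map_one _
        rw [h3, hU1] at hμ
        exact hhx (mul_inv_eq_iff_eq_mul.1 hμ)
    · exact h1
  obtain ⟨β, rfl⟩ := sl_U_surj x hx1 hx U hU c hc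
  have : β ∈ W := by rw [hW]; trivial
  have := this 1 (by rw [hU1]; exact hxS)
  rwa [one_mul] at this

theorem sl_good (n : ℕ) (hn : n.Prime) [Fintype F] (hF : Fintype.card F = 2 ^ n) :
    Good n SL2 where
  ca := sl_ca
  inv := sl_invol
  fus p h hc := sl_fus _ p (sl_trace_conj p h) hc
  gen := sl_gen (fun a => by
    obtain ⟨b, hb⟩ := FiniteField.isSquare_of_char_two (ringChar.eq F 2) a
    exact ⟨b, hb.symm⟩)
  card x hx1 hx := by
    obtain ⟨U, hU⟩ := sl_U x hx
    rw [← hF, ← Nat.card_eq_fintype_card]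
    symm
    refine Nat.card_congr (Equiv.ofBijective (fun β => ⟨U β, ?_⟩) ⟨?_, ?_⟩)
    · rw [Subgroup.mem_centralizer_singleton_iff]
      exact sl_U_comm x U hU β
    · intro β γ h
      exact sl_U_inj x hx1 hx U hU (congrArg Subtype.val h)
    · rintro ⟨c, hc⟩
      rw [Subgroup.mem_centralizer_singleton_iff] at hc
      obtain ⟨β, hβ⟩ := sl_U_surj x hx1 hx U hU c hc
      exact ⟨β, Subtype.ext hβ.symm⟩
  full x h hx1 hx S := sl_full n hn hF x h hx1 hx S
  tor x g h hx1 hx hg hh := by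
    obtain ⟨U, hU⟩ := sl_U x hx
    obtain ⟨μ, hμ⟩ := sl_U_surj x hx1 hx U hU _ hg
    obtain ⟨ν, hν⟩ := sl_U_surj x hx1 hx U hU _ hh
    calc (g * h) * x * (g * h)⁻¹ = g * (h * x * h⁻¹) * g⁻¹ := by group
      _ = h * (g * x * g⁻¹) * h⁻¹ := by
        rw [hμ, hν, sl_U_conj x U hU g μ ν hμ, sl_U_conj x U hU h ν μ hν, mul_comm]
      _ = (h * g) * x * (h * g)⁻¹ := by group
  ex := sl_ex

theorem sl_center : Subgroup.center SL2 = ⊥ := by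
  rw [eq_bot_iff]
  intro z hz
  rw [Subgroup.mem_bot]
  by_contra h
  obtain ⟨u, u1, u2, u3, u4⟩ := sl_mk (F := F) 1 1 0 1 (by ring)
  obtain ⟨l, l1, l2, l3, l4⟩ := sl_mk (F := F) 1 0 1 1 (by ring)
  rw [Subgroup.mem_center_iff] at hz
  have := sl_ca z u l h (hz u) (hz l)
  rw [sl_commute] at this
  simp [u2, l3, l2] at this

end Mat2

theorem stmt0 (n : ℕ) (hn : n.Prime) (F : Type*) [Field F] [Fintype F]
    (hF : Fintype.card F = 2 ^ n)
    (H : Subgroup (Matrix.ProjectiveSpecialLinearGroup (Fin 2) F)) :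
    ¬ IsPronormal H ↔
      ∃ j : ℕ, 1 ≤ j ∧ j < n ∧
        Nonempty (H ≃* (Fin j → Multiplicative (ZMod 2))) := by
  have hch : CharP F 2 := by
    obtain ⟨p, hp⟩ := CharP.exists F
    obtain ⟨k, hpp, hk⟩ := FiniteField.card F p
    rw [hF] at hk
    have h1 : p ∣ 2 ^ n := by rw [hk]; exact dvd_pow_self p k.ne_zero
    have h2 := (Nat.prime_dvd_prime_iff_eq hpp Nat.prime_two).1 (hpp.dvd_of_dvd_pow h1)
    rwa [h2] at hp
  have hG := sl_good n hn hF
  have hfin : Finite (Matrix.SpecialLinearGroup (Fin 2) F) := inferInstance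
  let e : Matrix.ProjectiveSpecialLinearGroup (Fin 2) F ≃* Matrix.SpecialLinearGroup (Fin 2) F :=
    (QuotientGroup.quotientMulEquivOfEq sl_center).trans QuotientGroup.quotientBot
  have h1 : IsPronormal H ↔ IsPronormal (H.map e.toMonoidHom) := by
    refine ⟨pronormal_of_equiv e H, fun h => ?_⟩
    have := pronormal_of_equiv e.symm _ h
    rw [Subgroup.map_map] at this
    have h2 : e.symm.toMonoidHom.comp e.toMonoidHom = MonoidHom.id _ := by ext x; simp
    rwa [h2, Subgroup.map_id] at this
  rw [h1, hG.main]
  let f : H ≃* H.map e.toMonoidHom := e.subgroupMap H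
  constructor
  · rintro ⟨j, a, b, ⟨u⟩⟩
    exact ⟨j, a, b, ⟨f.trans u⟩⟩
  · rintro ⟨j, a, b, ⟨u⟩⟩
    exact ⟨j, a, b, ⟨f.symm.trans u⟩⟩
end

section
/- Let n be an odd prime, q = 3^n, and G = PSL(2, F_q) the projective special linear group of degree 2 over the field with q elements. Then a subgroup H of G fails to be pronormal in G if and only if either H has order 2, or there exists an integer j with 1 ≤ j < n such that H is isomorphic to the elementary abelian group (ℤ/3ℤ)^j. In particular, every other subgroup of G is pronormal in G. -/
namespace PronPSL
open Matrix

section mat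
variable {F : Type*} [Field F]

/-- the `2×2` matrix of determinant one with given entries -/
def M2 (a b c d : F) (h : a * d - b * c = 1) : Matrix.SpecialLinearGroup (Fin 2) F :=
  ⟨!![a, b; c, d], by rw [det_fin_two_of]; exact h⟩

/-- its image in `PSL₂` -/
def P2 (a b c d : F) (h : a * d - b * c = 1) : ProjectiveSpecialLinearGroup (Fin 2) F :=
  QuotientGroup.mk (M2 a b c d h)

lemma M2_coe {a b c d : F} (h : a * d - b * c = 1) :
    ((M2 a b c d h : Matrix.SpecialLinearGroup (Fin 2) F) : Matrix (Fin 2) (Fin 2) F)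
      = !![a, b; c, d] := rfl

lemma P2_surj (x : ProjectiveSpecialLinearGroup (Fin 2) F) :
    ∃ a b c d, ∃ h : a * d - b * c = 1, x = P2 a b c d h := by
  obtain ⟨A, rfl⟩ := QuotientGroup.mk_surjective x
  have hA := A.det_coe
  rw [det_fin_two] at hA
  refine ⟨A 0 0, A 0 1, A 1 0, A 1 1, hA, ?_⟩
  unfold P2
  congr 1
  ext i j
  fin_cases i <;> fin_cases j <;> rfl

lemma M2_mul {a b c d e f g k : F} (h : a * d - b * c = 1) (h' : e * k - f * g = 1) :
    M2 a b c d h * M2 e f g k h' = M2 (a * e + b * g) (a * f + b * k) (c * e + d * g)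
      (c * f + d * k) (by linear_combination (e * k - f * g) * h + h') := by
  apply Subtype.ext
  rw [Matrix.SpecialLinearGroup.coe_mul, M2_coe, M2_coe, M2_coe]
  simp

lemma M2_inv {a b c d : F} (h : a * d - b * c = 1) :
    (M2 a b c d h)⁻¹ = M2 d (-b) (-c) a (by linear_combination h) := by
  apply Subtype.ext
  rw [Matrix.SpecialLinearGroup.coe_inv, M2_coe, M2_coe]
  simp [adjugate_fin_two]

lemma P2_mul {a b c d e f g k : F} (h : a * d - b * c = 1) (h' : e * k - f * g = 1) :
    P2 a b c d h * P2 e f g k h' = P2 (a * e + b * g) (a * f + b * k) (c * e + d * g)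
      (c * f + d * k) (by linear_combination (e * k - f * g) * h + h') := by
  rw [P2, P2, P2, ← M2_mul h h']; rfl

lemma P2_inv {a b c d : F} (h : a * d - b * c = 1) :
    (P2 a b c d h)⁻¹ = P2 d (-b) (-c) a (by linear_combination h) := by
  rw [P2, P2, ← M2_inv h]; rfl

lemma one_eq : (1 : ProjectiveSpecialLinearGroup (Fin 2) F) = P2 1 0 0 1 (by ring) := by
  rw [P2]
  symm
  convert QuotientGroup.mk_one (Subgroup.center (Matrix.SpecialLinearGroup (Fin 2) F))
  apply Subtype.ext
  exact one_fin_two.symm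

lemma P2_eq {a b c d e f g k : F} {h : a * d - b * c = 1} {h' : e * k - f * g = 1} :
    P2 a b c d h = P2 e f g k h' ↔ (a = e ∧ b = f ∧ c = g ∧ d = k) ∨
      (a = -e ∧ b = -f ∧ c = -g ∧ d = -k) := by
  rw [P2, P2, QuotientGroup.eq, Matrix.SpecialLinearGroup.mem_center_iff]
  have key : ∀ r : F, (scalar (Fin 2) r = ((M2 a b c d h)⁻¹ * M2 e f g k h' :
      Matrix.SpecialLinearGroup (Fin 2) F)) ↔ (e = r * a ∧ f = r * b ∧ g = r * c ∧ k = r * d) := by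
    intro r
    rw [M2_inv, M2_mul]
    rw [M2_coe]
    simp only [← Matrix.ext_iff]
    simp [Fin.forall_fin_two]
    constructor
    · rintro ⟨⟨h1, h2⟩, h3, h4⟩
      refine ⟨?_, ?_, ?_, ?_⟩
      · linear_combination -a * h1 - b * h3 - e * h
      · linear_combination -a * h2 - b * h4 - f * h
      · linear_combination -c * h1 - d * h3 - g * h
      · linear_combination -c * h2 - d * h4 - k * h
    · rintro ⟨rfl, rfl, rfl, rfl⟩
      refine ⟨⟨?_, ?_⟩, ?_, ?_⟩
      · linear_combination -r * h
      · ring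
      · ring
      · linear_combination -r * h
  constructor
  · rintro ⟨r, hr, hs⟩
    obtain ⟨rfl, rfl, rfl, rfl⟩ := (key r).1 hs
    simp only [Fintype.card_fin] at hr
    rcases sq_eq_one_iff.1 hr with rfl | rfl
    · left; simp
    · right; simp
  · rintro (⟨rfl, rfl, rfl, rfl⟩ | ⟨rfl, rfl, rfl, rfl⟩)
    · exact ⟨1, by simp, (key 1).2 (by simp)⟩
    · exact ⟨-1, by simp, (key (-1)).2 (by simp)⟩

lemma P2_sq_eq_one {a b c d : F} {h : a * d - b * c = 1} (ht : a + d = 0) :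
    P2 a b c d h ^ 2 = 1 := by
  rw [one_eq, pow_two, P2_mul, P2_eq]
  right
  refine ⟨?_, ?_, ?_, ?_⟩
  · linear_combination a * ht - h
  · linear_combination b * ht
  · linear_combination c * ht
  · linear_combination d * ht - h

lemma P2_trace_zero {a b c d : F} {h : a * d - b * c = 1} (h2 : P2 a b c d h ^ 2 = 1)
    (h1 : P2 a b c d h ≠ 1) : a + d = 0 := by
  by_contra ht
  apply h1
  rw [one_eq, pow_two, P2_mul, P2_eq] at h2
  rw [one_eq, P2_eq]
  have hb : b = 0 := by
    have : b * (a + d) = 0 := by rcases h2 with h2 | h2 <;> linear_combination h2.2.1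
    simpa [ht] using this
  have hc : c = 0 := by
    have : c * (a + d) = 0 := by rcases h2 with h2 | h2 <;> linear_combination h2.2.2.1
    simpa [ht] using this
  subst hb hc
  have had : a = d := by
    have : (a - d) * (a + d) = 0 := by
      rcases h2 with h2 | h2 <;> linear_combination h2.1 - h2.2.2.2
    rcases mul_eq_zero.1 this with h | h
    · linear_combination h
    · exact absurd h ht
  subst had
  have : a ^ 2 = 1 := by linear_combination h
  rcases sq_eq_one_iff.1 this with rfl | rfl <;> simp

/-- commuting in PSL: either cross products vanish, or both have trace zero -/
lemma P2_comm {a b c d e f g k : F} (two : (2 : F) ≠ 0) {h : a * d - b * c = 1}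
    {h' : e * k - f * g = 1} (ht : a + d ≠ 0) :
    P2 a b c d h * P2 e f g k h' = P2 e f g k h' * P2 a b c d h ↔
      (b * g = c * f ∧ b * (e - k) = f * (a - d) ∧ c * (e - k) = g * (a - d)) := by
  rw [P2_mul, P2_mul, P2_eq]
  constructor
  · rintro (⟨h1, h2, h3, h4⟩ | ⟨h1, h2, h3, h4⟩)
    · refine ⟨?_, ?_, ?_⟩
      · linear_combination h1
      · linear_combination -h2
      · linear_combination h3
    · exfalso
      have : 2 * (a + d) = 0 := by
        linear_combination k * h1 - g * h2 - f * h3 + e * h4 - 2 * (a + d) * h'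
      exact ht ((mul_eq_zero.1 this).resolve_left two)
  · rintro ⟨h1, h2, h3⟩
    left
    refine ⟨?_, ?_, ?_, ?_⟩
    · linear_combination h1
    · linear_combination -h2
    · linear_combination h3
    · linear_combination -h1

end mat
end PronPSL

namespace PronPSL
open Matrix

section mat2
variable {F : Type*} [Field F]


lemma P2_comm_of {a b c d e f g k : F} {h : a * d - b * c = 1}
    {h' : e * k - f * g = 1}
    (h1 : b * g = c * f) (h2 : b * (e - k) = f * (a - d)) (h3 : c * (e - k) = g * (a - d)) :
    P2 a b c d h * P2 e f g k h' = P2 e f g k h' * P2 a b c d h := by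
  rw [P2_mul, P2_mul, P2_eq]
  left
  refine ⟨?_, ?_, ?_, ?_⟩
  · linear_combination h1
  · linear_combination -h2
  · linear_combination h3
  · linear_combination -h1

lemma P2_nonscalar {a b c d : F} {h : a * d - b * c = 1} (hx : P2 a b c d h ≠ 1) :
    b ≠ 0 ∨ c ≠ 0 ∨ a - d ≠ 0 := by
  by_contra! hh
  obtain ⟨rfl, rfl, h3⟩ := hh
  apply hx
  obtain rfl : a = d := by linear_combination h3
  rw [one_eq, P2_eq]
  have : a ^ 2 = 1 := by linear_combination h
  rcases sq_eq_one_iff.1 this with rfl | rfl <;> simp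

lemma P2_trace_ne {a b c d : F} {h : a * d - b * c = 1} (hx : P2 a b c d h ^ 2 ≠ 1) :
    a + d ≠ 0 := fun ht => hx (P2_sq_eq_one ht)

/-- parallel vectors -/
lemma parallel {b c u f g v : F} (hn : b ≠ 0 ∨ c ≠ 0 ∨ u ≠ 0) (h1 : b * g = c * f)
    (h2 : b * v = f * u) (h3 : c * v = g * u) :
    ∃ r, f = r * b ∧ g = r * c ∧ v = r * u := by
  rcases hn with hn | hn | hn
  · refine ⟨f / b, ?_, ?_, ?_⟩ <;> field_simp
    · linear_combination h1
    · linear_combination h2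
  · refine ⟨g / c, ?_, ?_, ?_⟩ <;> field_simp
    · linear_combination -h1
    · linear_combination h3
  · refine ⟨v / u, ?_, ?_, ?_⟩ <;> field_simp
    · linear_combination -h2
    · linear_combination -h3

lemma fM1 (two : (2 : F) ≠ 0) {x y z : (ProjectiveSpecialLinearGroup (Fin 2) F)} (hx : x ^ 2 ≠ 1) (hy : x * y = y * x)
    (hz : x * z = z * x) : y * z = z * y := by
  have hx1 : x ≠ 1 := by rintro rfl; simp at hx
  obtain ⟨a, b, c, d, h, rfl⟩ := P2_surj x
  obtain ⟨a', b', c', d', h', rfl⟩ := P2_surj y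
  obtain ⟨a'', b'', c'', d'', h'', rfl⟩ := P2_surj z
  rw [P2_comm two (P2_trace_ne hx)] at hy hz
  obtain ⟨r, r1, r2, r3⟩ := parallel (P2_nonscalar hx1) hy.1 hy.2.1 hy.2.2
  obtain ⟨s, s1, s2, s3⟩ := parallel (P2_nonscalar hx1) hz.1 hz.2.1 hz.2.2
  apply P2_comm_of
  · rw [r1, r2, s1, s2]; ring
  · rw [r1, r3, s1, s3]; ring
  · rw [r2, r3, s2, s3]; ring

lemma fM4aux {a b c e f g : F} {h : a * (-a) - b * c = 1} {h' : e * (-e) - f * g = 1}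
    (two : (2 : F) ≠ 0)
    (h1 : b * g = c * f) (h2 : b * (2 * e) = f * (2 * a)) (h3 : c * (2 * e) = g * (2 * a)) :
    P2 a b c (-a) h = P2 e f g (-e) h' := by
  have hn : b ≠ 0 ∨ c ≠ 0 ∨ 2 * a ≠ 0 := by
    by_contra! hh
    obtain ⟨rfl, rfl, h4⟩ := hh
    obtain rfl := (mul_eq_zero.1 h4).resolve_left two
    simp at h
  obtain ⟨r, r1, r2, r3⟩ := parallel hn h1 h2 h3
  have r3' : e = r * a := by
    apply mul_left_cancel₀ two; linear_combination r3
  subst r1 r2 r3'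
  have : r ^ 2 = 1 := by linear_combination -r ^ 2 * h + h'
  rw [P2_eq]
  rcases sq_eq_one_iff.1 this with rfl | rfl
  · left; simp
  · right; simp

lemma inv_form {x : (ProjectiveSpecialLinearGroup (Fin 2) F)} (h2 : x ^ 2 = 1) (h1 : x ≠ 1) :
    ∃ a b c, ∃ h : a * (-a) - b * c = 1, x = P2 a b c (-a) h := by
  obtain ⟨a, b, c, d, h, rfl⟩ := P2_surj x
  have := P2_trace_zero h2 h1
  obtain rfl : d = -a := by linear_combination this
  exact ⟨a, b, c, h, rfl⟩

lemma fM4 (two : (2 : F) ≠ 0) {x y z : (ProjectiveSpecialLinearGroup (Fin 2) F)} (hx : x ^ 2 ≠ 1) (hy : x * y = y * x)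
    (hz : x * z = z * x) (hy2 : y ^ 2 = 1) (hy1 : y ≠ 1) (hz2 : z ^ 2 = 1) (hz1 : z ≠ 1) :
    y = z := by
  have hx1 : x ≠ 1 := by rintro rfl; simp at hx
  obtain ⟨a, b, c, d, h, rfl⟩ := P2_surj x
  obtain ⟨a', b', c', h', rfl⟩ := inv_form hy2 hy1
  obtain ⟨a'', b'', c'', h'', rfl⟩ := inv_form hz2 hz1
  rw [P2_comm two (P2_trace_ne hx)] at hy hz
  obtain ⟨r, r1, r2, r3⟩ := parallel (P2_nonscalar hx1) hy.1 hy.2.1 hy.2.2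
  obtain ⟨s, s1, s2, s3⟩ := parallel (P2_nonscalar hx1) hz.1 hz.2.1 hz.2.2
  apply fM4aux two
  · rw [r1, r2, s1, s2]; ring
  · linear_combination b' * s3 + s * (a - d) * r1 - b'' * r3 - r * (a - d) * s1
  · linear_combination c' * s3 + s * (a - d) * r2 - c'' * r3 - r * (a - d) * s2

/-- distinct commuting involutions are orthogonal -/
lemma inv_orth (two : (2 : F) ≠ 0) {a b c e f g : F} {h : a * (-a) - b * c = 1}
    {h' : e * (-e) - f * g = 1} (hne : P2 a b c (-a) h ≠ P2 e f g (-e) h')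
    (hc : P2 a b c (-a) h * P2 e f g (-e) h' = P2 e f g (-e) h' * P2 a b c (-a) h) :
    2 * a * e + b * g + c * f = 0 := by
  rw [P2_mul, P2_mul, P2_eq] at hc
  rcases hc with ⟨h1, h2, h3, h4⟩ | ⟨h1, h2, h3, h4⟩
  · exfalso
    apply hne
    apply fM4aux two
    · linear_combination h1
    · linear_combination -h2
    · linear_combination h3
  · linear_combination h1

lemma fM5 (two : (2 : F) ≠ 0) {x y z : (ProjectiveSpecialLinearGroup (Fin 2) F)} (hx2 : x ^ 2 = 1) (hx1 : x ≠ 1)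
    (hy2 : y ^ 2 = 1) (hy1 : y ≠ 1) (hz2 : z ^ 2 = 1) (hz1 : z ≠ 1)
    (hxy : x * y = y * x) (hxz : x * z = z * x) (hyz : y * z = z * y)
    (nxy : x ≠ y) (nxz : x ≠ z) (nyz : y ≠ z) : z = x * y := by
  obtain ⟨a, b, c, h, rfl⟩ := inv_form hx2 hx1
  obtain ⟨e, f, g, h', rfl⟩ := inv_form hy2 hy1
  obtain ⟨l, m, n, h'', rfl⟩ := inv_form hz2 hz1
  have o1 := inv_orth two nxy hxy
  have o2 := inv_orth two nxz hxz
  have o3 := inv_orth two nyz hyz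
  have hk : ∀ k, k = -(a * e + b * g) → ∀ hh, P2 (a * e + b * g) (a * f + b * -e) (c * e + -a * g) k hh =
      P2 l m n (-l) h'' := by
    rintro k rfl hh
    apply fM4aux two
    · linear_combination a * o3 - e * o2
    · linear_combination f * o2 - b * o3 - m * o1
    · linear_combination c * o3 - g * o2 - n * o1
  rw [P2_mul, hk]
  linear_combination o1

lemma fM3 (hns : ∀ r : F, r ^ 2 ≠ -1) (h3 : (3 : F) = 0) {y : (ProjectiveSpecialLinearGroup (Fin 2) F)} (hy : y ^ 4 = 1) :
    y ^ 2 = 1 := by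
  by_contra hne
  have h4 : (y ^ 2) ^ 2 = 1 := by rw [← pow_mul]; exact hy
  obtain ⟨a, b, c, d, h, rfl⟩ := P2_surj y
  rw [pow_two (P2 a b c d h), P2_mul] at hne h4
  have := P2_trace_zero h4 hne
  apply hns (a + d)
  linear_combination this + 2 * h + h3

lemma orth_comm {a b c d e f g k : F} {h : a * d - b * c = 1}
    {h' : e * k - f * g = 1} (h1 : a + d = 0) (h2 : e + k = 0)
    (h3 : 2 * a * e + b * g + c * f = 0) :
    P2 a b c d h * P2 e f g k h' = P2 e f g k h' * P2 a b c d h := by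
  obtain rfl : d = -a := by linear_combination h1
  obtain rfl : k = -e := by linear_combination h2
  rw [P2_mul, P2_mul, P2_eq]
  right
  refine ⟨?_, ?_, ?_, ?_⟩
  · linear_combination h3
  · ring
  · ring
  · linear_combination h3

lemma conj_form {a b c d p q r s : F} (h : a * d - b * c = 1) (hg : p * s - q * r = 1) :
    (P2 p q r s hg)⁻¹ * P2 a b c d h * P2 p q r s hg =
      P2 (s * (a * p + b * r) - q * (c * p + d * r)) (s * (a * q + b * s) - q * (c * q + d * s))
        (-r * (a * p + b * r) + p * (c * p + d * r)) (-r * (a * q + b * s) + p * (c * q + d * s))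
        (by linear_combination (p * s - q * r) ^ 2 * h + (p * s - q * r + 1) * hg) := by
  rw [mul_assoc, P2_inv, P2_mul, P2_mul, P2_eq]
  left
  refine ⟨?_, ?_, ?_, ?_⟩ <;> ring

lemma fM6 (hns : ∀ r : F, r ^ 2 ≠ -1) (h3 : (3 : F) = 0) {t : (ProjectiveSpecialLinearGroup (Fin 2) F)} (ht : t ^ 2 = 1) (ht1 : t ≠ 1) :
    ∃ g : (ProjectiveSpecialLinearGroup (Fin 2) F), g⁻¹ * t * g ≠ t ∧ t * (g⁻¹ * t * g) = (g⁻¹ * t * g) * t := by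
  have two : (2 : F) ≠ 0 := fun h => one_ne_zero (α := F) (by linear_combination h3 - h)
  obtain ⟨a, b, c, h, rfl⟩ := inv_form ht ht1
  have hb : b ≠ 0 := by
    rintro rfl
    apply hns a
    linear_combination -h
  obtain ⟨r, hr⟩ : ∃ r, b * r = 1 := ⟨b⁻¹, mul_inv_cancel₀ hb⟩
  refine ⟨P2 1 0 r 1 (by ring), ?_, ?_⟩
  · rw [conj_form, Ne, P2_eq]
    rintro (⟨h1, h2, _, h4⟩ | ⟨h1, h2, _, h4⟩)
    · apply one_ne_zero (α := F)
      linear_combination h1 - hr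
    · apply hb
      apply (mul_eq_zero.1 (_ : 2 * b = 0)).resolve_left two
      linear_combination h2
  · rw [conj_form]
    apply orth_comm
    · ring
    · ring
    · linear_combination -2 * h - (b * r + 1) * hr - h3

lemma fM2 (h3 : (3 : F) = 0) {x g : (ProjectiveSpecialLinearGroup (Fin 2) F)} (hx2 : x ^ 2 ≠ 1) (hx3 : x ^ 3 ≠ 1)
    (hc : x * (g⁻¹ * x * g) = (g⁻¹ * x * g) * x) :
    g⁻¹ * x * g = x ∨ ∀ y, x * y = y * x → g⁻¹ * y * g = y⁻¹ := by
  have two : (2 : F) ≠ 0 := fun h => one_ne_zero (α := F) (by linear_combination h3 - h)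
  have hx1 : x ≠ 1 := by rintro rfl; simp at hx2
  obtain ⟨a, b, c, d, h, rfl⟩ := P2_surj x
  obtain ⟨p, q, r, s, hg, rfl⟩ := P2_surj g
  have ht := P2_trace_ne hx2
  have hD : (a - d) ^ 2 + 4 * b * c ≠ 0 := by
    intro hD
    apply hx3
    have ht2 : (a + d) ^ 2 = 1 := by linear_combination hD + 4 * h + h3
    rw [one_eq, pow_succ, pow_two, P2_mul, P2_mul, P2_eq]
    rcases sq_eq_one_iff.1 ht2 with ht1 | ht1
    · right
      refine ⟨?_, ?_, ?_, ?_⟩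
      · linear_combination a * ht2 - (a + (a + d)) * h - ht1
      · linear_combination b * ht2 - b * h
      · linear_combination c * ht2 - c * h
      · linear_combination d * ht2 - (d + (a + d)) * h - ht1
    · left
      refine ⟨?_, ?_, ?_, ?_⟩
      · linear_combination a * ht2 - (a + (a + d)) * h - ht1
      · linear_combination b * ht2 - b * h
      · linear_combination c * ht2 - c * h
      · linear_combination d * ht2 - (d + (a + d)) * h - ht1
  rw [conj_form] at hc ⊢
  rw [P2_comm two ht] at hc
  obtain ⟨m, m1, m2, m3⟩ := parallel (P2_nonscalar hx1) hc.1 hc.2.1 hc.2.2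
  have hm : m ^ 2 = 1 := by
    apply mul_right_cancel₀ hD
    rw [one_mul]
    have e1 : m ^ 2 * ((a - d) ^ 2 + 4 * b * c) = (m * (a - d)) ^ 2 + 4 * (m * b) * (m * c) := by
      ring
    rw [e1, ← m1, ← m2, ← m3]
    linear_combination ((a - d) ^ 2 + 4 * b * c) * (p * s - q * r + 1) * hg
  have htr : (s * (a * p + b * r) - q * (c * p + d * r)) +
      (-r * (a * q + b * s) + p * (c * q + d * s)) = a + d := by
    linear_combination (a + d) * hg
  rcases sq_eq_one_iff.1 hm with rfl | rfl
  · left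
    rw [P2_eq]
    left
    refine ⟨?_, ?_, ?_, ?_⟩
    · apply mul_left_cancel₀ two
      linear_combination m3 + htr
    · linear_combination m1
    · linear_combination m2
    · apply mul_left_cancel₀ two
      linear_combination htr - m3
  · right
    intro y hy
    obtain ⟨a', b', c', d', h', rfl⟩ := P2_surj y
    rw [P2_comm two ht] at hy
    obtain ⟨u, u1, u2, u3⟩ := parallel (P2_nonscalar hx1) hy.1 hy.2.1 hy.2.2
    obtain ⟨v, hv⟩ : ∃ v, v = a' - u * a := ⟨_, rfl⟩
    obtain rfl : a' = u * a + v := by rw [hv]; ring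
    obtain rfl : d' = u * d + v := by linear_combination -u3
    subst u1 u2
    rw [conj_form, P2_inv, P2_eq]
    left
    have k1 : (s * (a * p + b * r) - q * (c * p + d * r)) = d := by
      apply mul_left_cancel₀ two
      linear_combination m3 + htr
    have k4 : -r * (a * q + b * s) + p * (c * q + d * s) = a := by
      apply mul_left_cancel₀ two
      linear_combination htr - m3
    refine ⟨?_, ?_, ?_, ?_⟩
    · linear_combination u * k1 + v * hg
    · linear_combination u * m1
    · linear_combination u * m2
    · linear_combination u * k4 + v * hg

/-- upper unipotents -/
def uu (s : F) : (ProjectiveSpecialLinearGroup (Fin 2) F) := P2 1 s 0 1 (by ring)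

/-- image of an upper triangular matrix -/
def IsUp (x : (ProjectiveSpecialLinearGroup (Fin 2) F)) : Prop := ∃ a b d, ∃ h : a * d - b * 0 = 1, x = P2 a b 0 d h

lemma uu_mul (s t : F) : uu s * uu t = uu (s + t) := by
  rw [uu, uu, uu, P2_mul, P2_eq]; left; simp [add_comm]

lemma uu_eq (two : (2 : F) ≠ 0) {s t : F} : uu s = uu t ↔ s = t := by
  rw [uu, uu, P2_eq]
  constructor
  · rintro (h | h)
    · exact h.2.1
    · exfalso; apply two; linear_combination h.1
  · rintro rfl; simp

lemma uu_zero : uu (0 : F) = 1 := by rw [one_eq]; rfl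

lemma comm_uu (two : (2 : F) ≠ 0) {s : F} (hs : s ≠ 0) {x : (ProjectiveSpecialLinearGroup (Fin 2) F)} (h : uu s * x = x * uu s) :
    ∃ t, x = uu t := by
  obtain ⟨a, b, c, d, hx, rfl⟩ := P2_surj x
  rw [uu, P2_comm two (by intro h; apply two; linear_combination h)] at h
  obtain ⟨h1, h2, -⟩ := h
  have hc : c = 0 := by simpa [hs] using h1
  have hd : a - d = 0 := by simpa [hs] using h2
  subst hc
  obtain rfl : a = d := by linear_combination hd
  have : a ^ 2 = 1 := by linear_combination hx
  rcases sq_eq_one_iff.1 this with rfl | rfl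
  · exact ⟨b, rfl⟩
  · refine ⟨-b, ?_⟩
    rw [uu, P2_eq]; right; simp

lemma up_of_conj {s t : F} (hs : s ≠ 0) {x : (ProjectiveSpecialLinearGroup (Fin 2) F)} (h : x⁻¹ * uu s * x = uu t) : IsUp x := by
  obtain ⟨a, b, c, d, hx, rfl⟩ := P2_surj x
  rw [uu, uu, conj_form, P2_eq] at h
  have : s * c ^ 2 = 0 := by
    rcases h with h | h
    · linear_combination -h.2.2.1
    · linear_combination -h.2.2.1
  have hc : c = 0 := by simpa [hs] using this
  subst hc
  exact ⟨a, b, d, hx, rfl⟩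

lemma conj_uu {a b d : F} (h : a * d - b * 0 = 1) (s : F) :
    (P2 a b 0 d h)⁻¹ * uu s * P2 a b 0 d h = uu (s * d ^ 2) := by
  rw [uu, uu, conj_form, P2_eq]
  left
  refine ⟨?_, ?_, ?_, ?_⟩
  · linear_combination h
  · ring
  · ring
  · linear_combination h

lemma up_comm {x y : (ProjectiveSpecialLinearGroup (Fin 2) F)} (hx : IsUp x) (hy : IsUp y) : ∃ s, x⁻¹ * y * x = y * uu s := by
  obtain ⟨a, b, d, h, rfl⟩ := hx
  obtain ⟨a', b', d', h', rfl⟩ := hy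
  refine ⟨d' * (d * (a' * b + b' * d) - b * d' * d) - b' * d', ?_⟩
  rw [uu, conj_form, P2_mul, P2_eq]
  left
  refine ⟨?_, ?_, ?_, ?_⟩
  · linear_combination a' * h
  · linear_combination (-(d * (a' * b + b' * d) - b * d' * d) + b') * h'
  · ring
  · linear_combination d' * h

lemma up_unip {a b d : F} (h : a * d - b * 0 = 1) (hd : d ^ 2 = 1) :
    ∃ t, P2 a b 0 d h = uu t := by
  rcases sq_eq_one_iff.1 hd with rfl | rfl
  · refine ⟨b, ?_⟩
    rw [uu, P2_eq]; left; refine ⟨?_, rfl, rfl, rfl⟩; linear_combination h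
  · refine ⟨-b, ?_⟩
    rw [uu, P2_eq]; right; refine ⟨?_, by ring, by ring, rfl⟩; linear_combination -h

end mat2
end PronPSL

namespace PronPSL
section grp
variable {Γ : Type*} [Group Γ]

lemma mem_conjugate {H : Subgroup Γ} {g y : Γ} : y ∈ H.conjugate g ↔ g * y * g⁻¹ ∈ H := by
  unfold Subgroup.conjugate
  constructor
  · rintro ⟨x, hx, rfl⟩
    have : g * ((MulAut.conj g⁻¹).toMonoidHom x) * g⁻¹ = x := by
      simp; group
    rw [this]; exact hx
  · intro h
    refine ⟨_, h, ?_⟩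
    simp; group

lemma conj_mem_conjugate {H : Subgroup Γ} {g y : Γ} (hy : y ∈ H) : g⁻¹ * y * g ∈ H.conjugate g := by
  rw [mem_conjugate]
  have : g * (g⁻¹ * y * g) * g⁻¹ = y := by group
  rwa [this]

lemma conjugate_mul (H : Subgroup Γ) (g k : Γ) :
    H.conjugate (g * k) = (H.conjugate g).conjugate k := by
  ext y
  rw [mem_conjugate, mem_conjugate, mem_conjugate]
  have : g * k * y * (g * k)⁻¹ = g * (k * y * k⁻¹) * g⁻¹ := by group
  rw [this]

lemma conjugate_one (H : Subgroup Γ) : H.conjugate 1 = H := by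
  ext y; rw [mem_conjugate]; simp

lemma conjugate_le_of_mem {H K : Subgroup Γ} {g : Γ} (h : H ≤ K) (hg : g ∈ K) :
    H.conjugate g ≤ K := by
  intro y hy
  rw [mem_conjugate] at hy
  have : y = g⁻¹ * (g * y * g⁻¹) * g := by group
  rw [this]
  exact K.mul_mem (K.mul_mem (K.inv_mem hg) (h hy)) hg

lemma conjugate_mono {H K : Subgroup Γ} {g : Γ} (h : H ≤ K) :
    H.conjugate g ≤ K.conjugate g := by
  intro y hy
  rw [mem_conjugate] at *
  exact h hy

lemma conjugate_of_mem {H : Subgroup Γ} {g : Γ} (hg : g ∈ H) : H.conjugate g = H := by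
  apply le_antisymm (conjugate_le_of_mem le_rfl hg)
  intro y hy
  rw [mem_conjugate]
  exact H.mul_mem (H.mul_mem hg hy) (H.inv_mem hg)

lemma card_conjugate (H : Subgroup Γ) (g : Γ) : Nat.card (H.conjugate g) = Nat.card H := by
  exact (Nat.card_congr (H.equivMapOfInjective (MulAut.conj g⁻¹).toMonoidHom
    (MulAut.conj g⁻¹).injective).toEquiv).symm

lemma conjugate_eq_of_le [Finite Γ] {H : Subgroup Γ} {g : Γ} (h : H.conjugate g ≤ H) :
    H.conjugate g = H :=
  Subgroup.eq_of_le_of_card_ge h (by rw [card_conjugate])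

lemma conjugate_eq_of_forall [Finite Γ] {H : Subgroup Γ} {g : Γ} (h : ∀ x ∈ H, g⁻¹ * x * g ∈ H) :
    H.conjugate g = H := by
  apply conjugate_eq_of_le
  intro y hy
  rw [mem_conjugate] at hy
  have := h _ hy
  have e : g⁻¹ * (g * y * g⁻¹) * g = y := by group
  rwa [e] at this

/-- reduction lemma -/
lemma pron_red {H : Subgroup Γ}
    (h : ∀ g : Γ, ∃ k ∈ H ⊔ H.conjugate g, ∃ x ∈ H ⊔ H.conjugate (g * k),
      H.conjugate x = H.conjugate (g * k)) : IsPronormal H := by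
  intro g
  obtain ⟨k, hk, x, hx, hxe⟩ := h g
  have hle : H ⊔ H.conjugate (g * k) ≤ H ⊔ H.conjugate g := by
    apply sup_le le_sup_left
    rw [conjugate_mul]
    exact conjugate_le_of_mem le_sup_right hk
  refine ⟨x * k⁻¹, Subgroup.mul_mem _ (hle hx) (Subgroup.inv_mem _ hk), ?_⟩
  rw [conjugate_mul, hxe, ← conjugate_mul]
  simp

lemma pron_red_one {H : Subgroup Γ}
    (h : ∀ g : Γ, ∃ k ∈ H ⊔ H.conjugate g, H.conjugate (g * k) = H) : IsPronormal H := by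
  apply pron_red
  intro g
  obtain ⟨k, hk, e⟩ := h g
  exact ⟨k, hk, 1, Subgroup.one_mem _, by rw [e, conjugate_one]⟩

lemma pron_conj {H : Subgroup Γ} (y : Γ) (h : IsPronormal H) : IsPronormal (H.conjugate y) := by
  intro g
  obtain ⟨x, hx, hxe⟩ := h (y * g * y⁻¹)
  refine ⟨y⁻¹ * x * y, ?_, ?_⟩
  · have h1 : y⁻¹ * x * y ∈ (H ⊔ H.conjugate (y * g * y⁻¹)).conjugate y := conj_mem_conjugate hx
    have h2 : (H ⊔ H.conjugate (y * g * y⁻¹)).conjugate y =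
        H.conjugate y ⊔ (H.conjugate (y * g * y⁻¹)).conjugate y := Subgroup.map_sup _ _ _
    rw [h2, ← conjugate_mul] at h1
    rw [← conjugate_mul]
    simpa [mul_assoc] using h1
  · rw [← conjugate_mul, ← conjugate_mul]
    have e1 : y * (y⁻¹ * x * y) = x * y := by group
    have e2 : y * g = (y * g * y⁻¹) * y := by group
    rw [e1, e2, conjugate_mul, hxe, ← conjugate_mul]

lemma pron_conj_iff {H : Subgroup Γ} (y : Γ) : IsPronormal (H.conjugate y) ↔ IsPronormal H := by
  refine ⟨fun h => ?_, pron_conj y⟩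
  have := pron_conj y⁻¹ h
  rwa [← conjugate_mul, mul_inv_cancel, conjugate_one] at this

lemma isPGroup_iff {p : ℕ} {P : Subgroup Γ} :
    IsPGroup p P ↔ ∀ x ∈ P, ∃ k, x ^ p ^ k = 1 := by
  constructor
  · intro h x hx
    obtain ⟨k, hk⟩ := h ⟨x, hx⟩
    exact ⟨k, congrArg Subtype.val hk⟩
  · rintro h ⟨x, hx⟩
    obtain ⟨k, hk⟩ := h x hx
    exact ⟨k, Subtype.ext hk⟩

/-- Sylow inside a subgroup `K` -/
lemma sylow_in [Finite Γ] {p : ℕ} (hp : p.Prime) {K P Q : Subgroup Γ} (hP : IsPGroup p P)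
    (hQ : IsPGroup p Q) (hPK : P ≤ K) (hQK : Q ≤ K) :
    ∃ k ∈ K, ∃ S : Subgroup Γ, IsPGroup p S ∧ S ≤ K ∧ P ≤ S ∧ Q.conjugate k ≤ S := by
  have := Fact.mk hp
  obtain ⟨S, hS⟩ := (hP.comap_of_injective K.subtype K.subtype_injective).exists_le_sylow
  obtain ⟨R, hR⟩ := (hQ.comap_of_injective K.subtype K.subtype_injective).exists_le_sylow
  obtain ⟨k, rfl⟩ := MulAction.exists_smul_eq K S R
  refine ⟨k, k.2, (S : Subgroup K).map K.subtype, S.2.map _, ?_, ?_, ?_⟩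
  · exact Subgroup.map_subtype_le _
  · intro x hx
    exact ⟨⟨x, hPK hx⟩, hS (by exact hx), rfl⟩
  · intro x hx
    rw [mem_conjugate] at hx
    have h1 := hR (show (⟨_, hQK hx⟩ : K) ∈ Q.comap K.subtype from hx)
    have h1' : (⟨_, hQK hx⟩ : K) ∈ ((k • S : Sylow p K) : Subgroup K) := h1
    rw [Sylow.coe_subgroup_smul, Subgroup.mem_pointwise_smul_iff_inv_smul_mem] at h1'
    refine ⟨_, h1', ?_⟩
    simp [← map_inv]
    group

lemma sylow_red [Finite Γ] {p : ℕ} (hp : p.Prime) {H P : Subgroup Γ} (hP : IsPGroup p P)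
    (hPH : P ≤ H) (hmax : ∀ Q : Subgroup Γ, IsPGroup p Q → P ≤ Q → Q ≤ P) (g : Γ) :
    ∃ k ∈ H ⊔ H.conjugate g, P.conjugate (g * k) = P := by
  obtain ⟨k, hk, S, hS, -, h1, h2⟩ := sylow_in (K := H ⊔ H.conjugate g) hp hP
    (Q := P.conjugate g) (hP.map _) (hPH.trans le_sup_left)
    ((conjugate_mono hPH).trans le_sup_right)
  refine ⟨k, hk, conjugate_eq_of_le ?_⟩
  rw [conjugate_mul]
  exact h2.trans (hmax S hS h1)

lemma transfer_lemma [Finite Γ] {p : ℕ} (hp : p.Prime) (K : Subgroup Γ)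
    (h : ∀ P : Subgroup Γ, P ≤ K → IsPGroup p P → ∀ g ∈ K, P.conjugate g = P →
      ∀ x ∈ P, g * x = x * g) :
    ∃ N : Subgroup Γ, N ≤ K ∧ ¬ p ∣ Nat.card N ∧ (∀ k ∈ K, ∀ x ∈ N, k⁻¹ * x * k ∈ N) ∧
      (∀ a ∈ K, ∀ b ∈ K, a⁻¹ * b⁻¹ * a * b ∈ N) ∧ ∀ k ∈ K, ∃ m, k ^ p ^ m ∈ N := by
  have := Fact.mk hp
  obtain ⟨P⟩ : Nonempty (Sylow p K) := inferInstance
  have hN : Subgroup.normalizer (P : Set K) ≤ Subgroup.centralizer (P : Set K) := by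
    intro g hg
    rw [Subgroup.mem_centralizer_iff]
    intro x hx
    have := h ((P : Subgroup K).map K.subtype) (Subgroup.map_subtype_le _) (P.2.map _) g g.2 ?_ x
      ⟨x, hx, rfl⟩
    · apply Subtype.ext
      exact this.symm
    · apply conjugate_eq_of_forall
      rintro _ ⟨y, hy, rfl⟩
      refine ⟨g⁻¹ * y * g, ?_, by simp⟩
      exact (Subgroup.mem_normalizer_iff''.1 hg y).1 hy
  let φ := MonoidHom.transferSylow P hN
  have hcomm : ∀ x y : P, x * y = y * x := by
    intro x y
    apply Subtype.ext
    exact Subgroup.mem_centralizer_iff.1 (hN (Subgroup.le_normalizer y.2)) x x.2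
  refine ⟨φ.ker.map K.subtype, Subgroup.map_subtype_le _, ?_, ?_, ?_, ?_⟩
  · have := MonoidHom.not_dvd_card_ker_transferSylow P hN
    rwa [Nat.card_congr (φ.ker.equivMapOfInjective K.subtype K.subtype_injective).toEquiv] at this
  · rintro k hk _ ⟨y, hy, rfl⟩
    refine ⟨(⟨k, hk⟩ : K)⁻¹ * y * ⟨k, hk⟩, ?_, by simp⟩
    have : φ y = 1 := hy
    show φ _ = 1
    simp [this]
  · intro a ha b hb
    refine ⟨(⟨a, ha⟩ : K)⁻¹ * (⟨b, hb⟩ : K)⁻¹ * ⟨a, ha⟩ * ⟨b, hb⟩, ?_, by simp⟩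
    show φ _ = 1
    simp only [map_mul, map_inv]
    rw [mul_assoc, hcomm (φ ⟨a, ha⟩)]
    group
  · intro k hk
    obtain ⟨m, hm⟩ := P.2 (φ ⟨k, hk⟩)
    refine ⟨m, ⟨(⟨k, hk⟩ : K) ^ p ^ m, ?_, by simp⟩⟩
    show φ _ = 1
    rw [map_pow, hm]

end grp
end PronPSL

namespace PronPSL
section abs
variable {Γ : Type*} [Group Γ]

/-- The elementary properties of `PSL₂(q)` used in the argument. -/
structure Ax (Γ : Type*) [Group Γ] : Prop where
  m1 : ∀ {x y z : Γ}, x ^ 2 ≠ 1 → x * y = y * x → x * z = z * x → y * z = z * y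
  m2 : ∀ {x g : Γ}, x ^ 2 ≠ 1 → x ^ 3 ≠ 1 → x * (g⁻¹ * x * g) = (g⁻¹ * x * g) * x →
    g⁻¹ * x * g = x ∨ ∀ y, x * y = y * x → g⁻¹ * y * g = y⁻¹
  m3 : ∀ {y : Γ}, y ^ 4 = 1 → y ^ 2 = 1
  m4 : ∀ {x y z : Γ}, x ^ 2 ≠ 1 → x * y = y * x → x * z = z * x → y ^ 2 = 1 → y ≠ 1 →
    z ^ 2 = 1 → z ≠ 1 → y = z
  m5 : ∀ {x y z : Γ}, x ^ 2 = 1 → x ≠ 1 → y ^ 2 = 1 → y ≠ 1 → z ^ 2 = 1 → z ≠ 1 →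
    x * y = y * x → x * z = z * x → y * z = z * y → x ≠ y → x ≠ z → y ≠ z → z = x * y

lemma sq_of_two_pow (ax : Ax Γ) {y : Γ} {m : ℕ} (h : y ^ 2 ^ m = 1) : y ^ 2 = 1 := by
  induction m with
  | zero => simp at h; simp [h]
  | succ m ih =>
    rcases m with _ | m
    · simpa using h
    · apply ih
      have : (y ^ 2 ^ m) ^ 4 = 1 := by
        rw [← pow_mul, ← h]; congr 1; ring
      have := ax.m3 this
      rw [← this, ← pow_mul]; congr 1

lemma comm_of_sq {a b : Γ} (ha : a ^ 2 = 1) (hb : b ^ 2 = 1) (hab : (a * b) ^ 2 = 1) :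
    a * b = b * a := by
  have ha' : a⁻¹ = a := inv_eq_of_mul_eq_one_left (by rw [← pow_two, ha])
  have hb' : b⁻¹ = b := inv_eq_of_mul_eq_one_left (by rw [← pow_two, hb])
  have hab' : (a * b)⁻¹ = a * b := inv_eq_of_mul_eq_one_left (by rw [← pow_two, hab])
  rw [mul_inv_rev, ha', hb'] at hab'
  exact hab'.symm

lemma two_sq (ax : Ax Γ) {Q : Subgroup Γ} (hQ : IsPGroup 2 Q) : ∀ x ∈ Q, x ^ 2 = 1 := by
  intro x hx
  obtain ⟨m, hm⟩ := isPGroup_iff.1 hQ x hx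
  exact sq_of_two_pow ax hm

lemma two_comm (ax : Ax Γ) {Q : Subgroup Γ} (hQ : IsPGroup 2 Q) :
    ∀ x ∈ Q, ∀ y ∈ Q, x * y = y * x := fun x hx y hy =>
  comm_of_sq (two_sq ax hQ x hx) (two_sq ax hQ y hy) (two_sq ax hQ _ (Q.mul_mem hx hy))

/-- the centralizer of a four-group -/
lemma cent_four (ax : Ax Γ) {a b c : Γ} (ha : a ^ 2 = 1) (ha1 : a ≠ 1) (hb : b ^ 2 = 1)
    (hb1 : b ≠ 1) (hab : a * b = b * a) (hne : a ≠ b) (h1 : c * a = a * c) (h2 : c * b = b * c) :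
    c = 1 ∨ c = a ∨ c = b ∨ c = a * b := by
  by_contra! hh
  obtain ⟨n1, n2, n3, n4⟩ := hh
  by_cases hc : c ^ 2 = 1
  · exact n4 (ax.m5 ha ha1 hb hb1 hc n1 hab h1.symm h2.symm hne n2.symm n3.symm)
  · exact hne (ax.m4 hc h1 h2 ha ha1 hb hb1)

lemma four_max (ax : Ax Γ) {P : Subgroup Γ} {a b : Γ} (haP : a ∈ P) (hbP : b ∈ P) (ha1 : a ≠ 1)
    (hb1 : b ≠ 1) (hne : a ≠ b) (Q : Subgroup Γ) (hQ : IsPGroup 2 Q) (hPQ : P ≤ Q) : Q ≤ P := by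
  intro c hc
  have hs := two_sq ax hQ
  have hcm := two_comm ax hQ
  rcases cent_four ax (hs a (hPQ haP)) ha1 (hs b (hPQ hbP)) hb1 (hcm a (hPQ haP) b (hPQ hbP)) hne
    (hcm c hc a (hPQ haP)) (hcm c hc b (hPQ hbP)) with rfl | rfl | rfl | rfl
  · exact P.one_mem
  · exact haP
  · exact hbP
  · exact P.mul_mem haP hbP

lemma conj_pres {P : Subgroup Γ} {g : Γ} (h : P.conjugate g = P) {x : Γ} (hx : x ∈ P) :
    g⁻¹ * x * g ∈ P := by
  have := conj_mem_conjugate (g := g) hx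
  rwa [h] at this

lemma conj_mul (g x y : Γ) : g⁻¹ * (x * y) * g = (g⁻¹ * x * g) * (g⁻¹ * y * g) := by group

lemma conj_eq_iff_comm {g x : Γ} : g⁻¹ * x * g = x ↔ g * x = x * g := by
  rw [mul_assoc, inv_mul_eq_iff_eq_mul, eq_comm]

lemma conj_inj {g x y : Γ} (h : g⁻¹ * x * g = g⁻¹ * y * g) : x = y := by simpa using h

/-- an element normalizing a four-group and fixing one of its involutions lies in it -/
lemma four_fix (ax : Ax Γ) {P : Subgroup Γ} (hP : IsPGroup 2 P) {c e : Γ} (hc : c ∈ P) (he : e ∈ P)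
    (hc1 : c ≠ 1) (he1 : e ≠ 1) (hce : c ≠ e) {g : Γ} (hg : P.conjugate g = P)
    (hgc : g⁻¹ * c * g = c) : g ∈ P := by
  have hs := two_sq ax hP
  have hcm := two_comm ax hP
  have four : ∀ {y : Γ}, y * c = c * y → y * e = e * y → y = 1 ∨ y = c ∨ y = e ∨ y = c * e :=
    fun h1 h2 => cent_four ax (hs c hc) hc1 (hs e he) he1 (hcm c hc e he) hce h1 h2
  have fourP : ∀ {y : Γ}, y * c = c * y → y * e = e * y → y ∈ P := by
    intro y h1 h2
    rcases four h1 h2 with rfl | rfl | rfl | rfl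
    · exact P.one_mem
    · exact hc
    · exact he
    · exact P.mul_mem hc he
  have hgc' := conj_eq_iff_comm.1 hgc
  have hm := conj_pres hg he
  rcases four (hcm _ hm c hc) (hcm _ hm e he) with h | h | h | h
  · exact absurd (conj_inj (h.trans (by group : (1 : Γ) = g⁻¹ * 1 * g))) he1
  · exact absurd (conj_inj (h.trans hgc.symm)) hce.symm
  · exact fourP hgc' (conj_eq_iff_comm.1 h)
  · exfalso
    have hcc : c * c = 1 := by rw [← pow_two, hs c hc]
    have hee : e * e = 1 := by rw [← pow_two, hs e he]
    have h2 : (g * g)⁻¹ * e * (g * g) = e := by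
      have : (g * g)⁻¹ * e * (g * g) = g⁻¹ * (g⁻¹ * e * g) * g := by group
      rw [this, h, conj_mul, hgc, h, ← mul_assoc, hcc, one_mul]
    have h2c : (g * g)⁻¹ * c * (g * g) = c := by
      have : (g * g)⁻¹ * c * (g * g) = g⁻¹ * (g⁻¹ * c * g) * g := by group
      rw [this, hgc, hgc]
    have h3 : (g * g) ∈ P := fourP (conj_eq_iff_comm.1 h2c) (conj_eq_iff_comm.1 h2)
    have h4 : g ^ 2 = 1 := by
      apply ax.m3
      have := hs _ h3
      rw [← this]; simp only [pow_succ, pow_zero, one_mul, mul_assoc]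
    have hg' : g⁻¹ = g := inv_eq_of_mul_eq_one_left (by rw [← pow_two, h4])
    have h5 : (g * e) ^ 2 = c := by
      calc (g * e) ^ 2 = (g * e * g) * e := by rw [pow_two]; group
        _ = (g⁻¹ * e * g) * e := by rw [hg']
        _ = c := by rw [h, mul_assoc, hee, mul_one]
    have h6 : (g * e) ^ 2 = 1 := by
      apply ax.m3
      rw [show 4 = 2 * 2 from rfl, pow_mul, h5, hs c hc]
    exact hc1 (h5.symm.trans h6)

lemma four_case [Finite Γ] (ax : Ax Γ) {H P : Subgroup Γ} (hPH : P ≤ H) (hP : IsPGroup 2 P) {h a : Γ}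
    (hh : h ∈ H) (hhP : P.conjugate h = P) (ha : a ∈ P) (hha : h * a ≠ a * h) : IsPronormal H := by
  have ha1 : a ≠ 1 := by rintro rfl; simp at hha
  obtain ⟨b, hb⟩ : ∃ b, b = h⁻¹ * a * h := ⟨_, rfl⟩
  have hbP : b ∈ P := hb ▸ conj_pres hhP ha
  have hb1 : b ≠ 1 := by
    rintro rfl
    exact ha1 (conj_inj (hb.symm.trans (by group : (1 : Γ) = h⁻¹ * 1 * h)))
  have hab : a ≠ b := by
    intro e
    exact hha (conj_eq_iff_comm.1 (hb.symm.trans e.symm))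
  have hs := two_sq ax hP
  have hcm := two_comm ax hP
  have four : ∀ y ∈ P, y = 1 ∨ y = a ∨ y = b ∨ y = a * b := fun y hy =>
    cent_four ax (hs a ha) ha1 (hs b hbP) hb1 (hcm a ha b hbP) hab (hcm y hy a ha) (hcm y hy b hbP)
  have hhnP : h ∉ P := fun hP' => hha (hcm h hP' a ha)
  have hbh : h⁻¹ * b * h = a * b := by
    rcases four _ (conj_pres hhP hbP) with e | e | e | e
    · exact absurd (conj_inj (e.trans (by group : (1 : Γ) = h⁻¹ * 1 * h))) hb1
    · exfalso
      apply hhnP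
      have hab1 : a * b ≠ 1 := by
        intro e'
        apply hab
        have : a * a = 1 := by rw [← pow_two, hs a ha]
        exact mul_left_cancel (this.trans e'.symm)
      refine four_fix ax hP (P.mul_mem ha hbP) ha hab1 ha1 ?_ hhP ?_
      · intro e'; exact hb1 (by simpa using e')
      · rw [conj_mul, ← hb, e]; exact hcm b hbP a ha
    · exact absurd (conj_inj (e.trans hb)).symm hab
    · exact e
  have hinv : P.conjugate h⁻¹ = P := by
    conv_lhs => rw [← hhP]
    rw [← conjugate_mul, mul_inv_cancel, conjugate_one]
  have key : ∀ g, P.conjugate g = P → g ∈ H := by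
    intro g hg
    have fix : ∀ g, P.conjugate g = P → g⁻¹ * a * g = a → g ∈ H := fun g hg hga =>
      hPH (four_fix ax hP ha hbP ha1 hb1 hab hg hga)
    rcases four _ (conj_pres hg ha) with e | e | e | e
    · exact absurd (conj_inj (e.trans (by group : (1 : Γ) = g⁻¹ * 1 * g))) ha1
    · exact fix g hg e
    · have : g * h⁻¹ ∈ H := by
        apply fix
        · rw [conjugate_mul, hg, hinv]
        · have : (g * h⁻¹)⁻¹ * a * (g * h⁻¹) = h * (g⁻¹ * a * g) * h⁻¹ := by group
          rw [this, e, hb]; group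
      have := H.mul_mem this hh
      simpa using this
    · have : g * h⁻¹ * h⁻¹ ∈ H := by
        apply fix
        · rw [conjugate_mul, conjugate_mul, hg, hinv, hinv]
        · have : (g * h⁻¹ * h⁻¹)⁻¹ * a * (g * h⁻¹ * h⁻¹) = h * (h * (g⁻¹ * a * g) * h⁻¹) * h⁻¹ := by
            simp only [mul_inv_rev, inv_inv, mul_assoc]
          rw [this, e, ← hbh, hb]; group
      have := H.mul_mem (H.mul_mem this hh) hh
      simpa using this
  apply pron_red_one
  intro g
  obtain ⟨k, hk, e⟩ := sylow_red Nat.prime_two hP hPH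
    (four_max ax ha hbP ha1 hb1 hab) g
  exact ⟨k, hk, conjugate_of_mem (key _ e)⟩

lemma pow_ne_of_prime {p : ℕ} (hp : p.Prime) {z : Γ} {k q : ℕ} (hz : z ^ p ^ k = 1) (hz1 : z ≠ 1)
    (hq : q.Prime) (hqp : q ≠ p) : z ^ q ≠ 1 := by
  intro h
  apply hz1
  have h1 := orderOf_dvd_of_pow_eq_one hz
  have h2 := orderOf_dvd_of_pow_eq_one h
  have : Nat.Coprime (p ^ k) q := ((Nat.coprime_primes hp hq).2 hqp.symm).pow_left k
  exact orderOf_eq_one_iff.1 (Nat.eq_one_of_dvd_coprimes this h1 h2)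

lemma odd_comm {g z : Γ} (hodd : Odd (orderOf g)) (h : g * g * z = z * (g * g)) :
    g * z = z * g := by
  obtain ⟨m, hm⟩ := hodd
  have hg : g = (g * g) ^ (m + 1) := by
    rw [← pow_two, ← pow_mul, show 2 * (m + 1) = orderOf g + 1 by omega, pow_succ,
      pow_orderOf_eq_one, one_mul]
  have : Commute ((g * g) ^ (m + 1)) z := Commute.pow_left h _
  rw [← hg] at this
  exact this

lemma center_elt [Finite Γ] {p : ℕ} (hp : p.Prime) {P : Subgroup Γ} (hP : IsPGroup p P)
    (hne : P ≠ ⊥) : ∃ z ∈ P, z ≠ 1 ∧ ∀ x ∈ P, z * x = x * z := by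
  have := Fact.mk hp
  have : Nontrivial P := (Subgroup.nontrivial_iff_ne_bot P).2 hne
  obtain ⟨⟨z, hz⟩, hz1⟩ := @exists_ne (Subgroup.center P) hP.center_nontrivial 1
  refine ⟨z, z.2, ?_, ?_⟩
  · intro h
    apply hz1
    apply Subtype.ext
    apply Subtype.ext
    exact h
  · intro x hx
    exact congrArg Subtype.val (Subgroup.mem_center_iff.1 hz ⟨x, hx⟩).symm

lemma transfer_hyp [Finite Γ] (ax : Ax Γ) {O : Subgroup Γ} (hO : ∀ g ∈ O, Odd (orderOf g)) {p : ℕ}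
    (hp : p.Prime) (hp2 : p ≠ 2) (hp3 : p ≠ 3) (P : Subgroup Γ) (hP : IsPGroup p P)
    (g : Γ) (hg : g ∈ O) (hgP : P.conjugate g = P) (x : Γ) (hx : x ∈ P) : g * x = x * g := by
  by_cases hb : P = ⊥
  · subst hb
    obtain rfl := Subgroup.mem_bot.1 hx
    simp
  obtain ⟨z, hz, hz1, hzc⟩ := center_elt hp hP hb
  obtain ⟨k, hk⟩ := isPGroup_iff.1 hP z hz
  have h2 := pow_ne_of_prime hp hk hz1 Nat.prime_two hp2.symm
  have h3 := pow_ne_of_prime hp hk hz1 Nat.prime_three hp3.symm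
  have hgz : g * z = z * g := by
    rcases ax.m2 h2 h3 (hzc _ (conj_pres hgP hz)) with h | h
    · exact conj_eq_iff_comm.1 h
    · apply odd_comm (hO g hg)
      rw [← conj_eq_iff_comm]
      have e : (g * g)⁻¹ * z * (g * g) = g⁻¹ * (g⁻¹ * z * g) * g := by group
      have e2 := h z rfl
      rw [e, e2, h z⁻¹ (by group), inv_inv]
  exact ax.m1 h2 hgz.symm (hzc x hx)

/-- torus case -/
lemma torus_case [Finite Γ] (ax : Ax Γ) {H : Subgroup Γ} {p : ℕ} (hp : p.Prime) (hp2 : p ≠ 2)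
    (hp3 : p ≠ 3) {x : Γ} (hxH : x ∈ H) (hxp : x ^ p = 1) (hx1 : x ≠ 1)
    (hH : ∀ h ∈ H, x * (h⁻¹ * x * h) = (h⁻¹ * x * h) * x) : IsPronormal H := by
  have hx2 := pow_ne_of_prime (k := 1) hp (by simpa using hxp) hx1 Nat.prime_two hp2.symm
  have hx3 := pow_ne_of_prime (k := 1) hp (by simpa using hxp) hx1 Nat.prime_three hp3.symm
  have dich : ∀ g : Γ, x * (g⁻¹ * x * g) = (g⁻¹ * x * g) * x →
      x * g = g * x ∨ ∀ y, x * y = y * x → g⁻¹ * y * g = y⁻¹ := by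
    intro g hg
    rcases ax.m2 hx2 hx3 hg with h | h
    · left; exact (conj_eq_iff_comm.1 h).symm
    · right; exact h
  -- the key case
  have key : ∀ s : Γ, x * s = s * x → ∃ w ∈ H ⊔ H.conjugate s, H.conjugate w = H.conjugate s := by
    intro s hs
    by_cases hT : ∀ h ∈ H, x * h = h * x
    · refine ⟨1, Subgroup.one_mem _, ?_⟩
      rw [conjugate_one]
      symm
      apply conjugate_eq_of_forall
      intro y hy
      rw [conj_eq_iff_comm.2 (ax.m1 hx2 hs (hT y hy))]
      exact hy
    push Not at hT
    obtain ⟨t, ht, htx⟩ := hT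
    have htinv := (dich t (hH t ht)).resolve_left htx
    have hts : s⁻¹ * t * s = t * s ^ 2 := by
      have h1 := htinv s hs
      have : s⁻¹ * t * s = t * (t⁻¹ * s * t)⁻¹ * s := by group
      rw [this, h1, inv_inv, pow_two, mul_assoc]
    have hs2 : s ^ 2 ∈ H ⊔ H.conjugate s := by
      have : s ^ 2 = t⁻¹ * (s⁻¹ * t * s) := by rw [hts]; group
      rw [this]
      exact Subgroup.mul_mem _ (Subgroup.inv_mem _ (Subgroup.mem_sup_left ht))
        (Subgroup.mem_sup_right (conj_mem_conjugate ht))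
    have hodd : Odd (orderOf (s ^ 2)) := by
      by_contra hev
      rw [Nat.not_odd_iff_even] at hev
      obtain ⟨m, hm⟩ := hev
      have hpos : 0 < orderOf (s ^ 2) := orderOf_pos _
      have h1 : (s ^ m) ^ 4 = 1 := by
        rw [← pow_mul, show m * 4 = 2 * (m + m) by ring, pow_mul, ← hm, pow_orderOf_eq_one]
      have h2 := ax.m3 h1
      rw [← pow_mul, mul_comm, pow_mul] at h2
      have := Nat.le_of_dvd (by omega) (orderOf_dvd_of_pow_eq_one h2)
      omega
    obtain ⟨m, hm⟩ := hodd
    have hw2 : ((s ^ 2) ^ (m + 1)) ^ 2 = s ^ 2 := by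
      rw [← pow_mul, show (m + 1) * 2 = orderOf (s ^ 2) + 1 by omega, pow_succ,
        pow_orderOf_eq_one, one_mul]
    refine ⟨(s ^ 2) ^ (m + 1), Subgroup.pow_mem _ hs2 _, ?_⟩
    obtain ⟨w, hw⟩ : ∃ w, w = (s ^ 2) ^ (m + 1) := ⟨_, rfl⟩
    rw [← hw] at hw2 ⊢
    have hsw : Commute s w := by rw [hw]; exact (Commute.refl s).pow_right 2 |>.pow_right _
    have hxw : Commute x w := by
      rw [hw]; exact ((show Commute x s from hs).pow_right 2).pow_right _
    obtain ⟨e, he⟩ : ∃ e, e = s * w⁻¹ := ⟨_, rfl⟩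
    have hxe : x * e = e * x := by
      rw [he]; exact (show Commute x s from hs).mul_right hxw.inv_right
    have he2 : e * e = 1 := by
      have : e ^ 2 = s ^ 2 * (w⁻¹) ^ 2 := by rw [he]; exact (hsw.inv_right).mul_pow 2
      rw [← pow_two, this, inv_pow, hw2, mul_inv_cancel]
    have he' : e⁻¹ = e := inv_eq_of_mul_eq_one_left he2
    have hes : s = e * w := by rw [he]; group
    rw [hes, conjugate_mul]
    congr 1
    symm
    apply conjugate_eq_of_forall
    intro y hy
    have : e * y = y * e := by
      rcases dich y (hH y hy) with h | h
      · exact ax.m1 hx2 hxe h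
      · have := h e hxe
        rw [he'] at this
        exact (conj_eq_iff_comm.1 this).symm
    rw [conj_eq_iff_comm.2 this]
    exact hy
  apply pron_red
  intro g
  have hpx : IsPGroup p (Subgroup.zpowers x) := by
    rw [isPGroup_iff]
    rintro _ ⟨m, rfl⟩
    refine ⟨1, ?_⟩
    show (x ^ m) ^ p ^ 1 = 1
    rw [pow_one, ← zpow_natCast, ← zpow_mul, mul_comm, zpow_mul, zpow_natCast, hxp, one_zpow]
  have hle : Subgroup.zpowers x ≤ H := by rwa [Subgroup.zpowers_le]
  obtain ⟨k, hk, S, hS, -, h1, h2⟩ := sylow_in (K := H ⊔ H.conjugate g) hp hpx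
    (Q := (Subgroup.zpowers x).conjugate g) (hpx.map _) (hle.trans le_sup_left)
    ((conjugate_mono hle).trans le_sup_right)
  refine ⟨k, hk, ?_⟩
  rw [← conjugate_mul] at h2
  have hxS : x ∈ S := h1 (Subgroup.mem_zpowers x)
  have hxS' := h2 (conj_mem_conjugate (g := g * k) (Subgroup.mem_zpowers x))
  obtain ⟨z, hz, hz1, hzc⟩ := center_elt hp hS (by
    rintro rfl
    exact hx1 (Subgroup.mem_bot.1 hxS))
  obtain ⟨j, hj⟩ := isPGroup_iff.1 hS z hz
  have hz2 := pow_ne_of_prime hp hj hz1 Nat.prime_two hp2.symm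
  have hcom := ax.m1 hz2 (hzc x hxS) (hzc _ hxS')
  obtain ⟨g1, hg1⟩ : ∃ g1, g1 = g * k := ⟨_, rfl⟩
  rw [← hg1] at hcom ⊢
  rcases dich g1 hcom with h | h
  · exact key g1 h
  · by_cases hT : ∀ h ∈ H, x * h = h * x
    · refine ⟨1, Subgroup.one_mem _, ?_⟩
      rw [conjugate_one]
      symm
      apply conjugate_eq_of_forall
      intro y hy
      rw [h y (hT y hy)]
      exact H.inv_mem hy
    push Not at hT
    obtain ⟨t, ht, htx⟩ := hT
    have htinv := (dich t (hH t ht)).resolve_left htx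
    have hs : x * (t⁻¹ * g1) = (t⁻¹ * g1) * x := by
      symm
      rw [← conj_eq_iff_comm]
      have e1 : (t⁻¹ * g1)⁻¹ * x * (t⁻¹ * g1) = g1⁻¹ * (t * x * t⁻¹) * g1 := by
        simp only [mul_inv_rev, inv_inv, mul_assoc]
      have e3 : t * x * t⁻¹ = x⁻¹ := by
        have e4 := htinv x⁻¹ (by group)
        rw [inv_inv] at e4
        calc t * x * t⁻¹ = t * (t⁻¹ * x⁻¹ * t) * t⁻¹ := by rw [e4]
          _ = x⁻¹ := by group
      rw [e1, e3, h x⁻¹ (by group), inv_inv]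
    have e2 : H.conjugate g1 = H.conjugate (t⁻¹ * g1) := by
      rw [conjugate_mul, conjugate_of_mem (H.inv_mem ht)]
    rw [e2]
    exact key _ hs

end abs
end PronPSL

namespace PronPSL
section abs2
variable {Γ : Type*} [Group Γ]

lemma mem_of_pow_mem {N : Subgroup Γ} {y : Γ} {a b : ℕ} (h : Nat.Coprime a b) (hy : y ^ a = 1)
    (hb : y ^ b ∈ N) : y ∈ N := by
  have e : y = (y ^ b) ^ (Nat.gcdB a b) := by
    have h1 := Nat.gcd_eq_gcd_ab a b
    rw [h.gcd_eq_one] at h1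
    calc y = y ^ ((1 : ℕ) : ℤ) := by simp
      _ = (y ^ b) ^ (Nat.gcdB a b) := by
        rw [h1, zpow_add, zpow_mul, zpow_mul, zpow_natCast, zpow_natCast, hy, one_zpow, one_mul]
  rw [e]
  exact N.zpow_mem hb _

lemma conj_pow' (h x : Γ) (n : ℕ) : (h⁻¹ * x * h) ^ n = h⁻¹ * x ^ n * h := by
  have := conj_pow (a := h⁻¹) (b := x) (i := n)
  simpa using this

lemma abs_main [Finite Γ] (ax : Ax Γ) (H : Subgroup Γ) :
    IsPronormal H ∨ Nat.card H = 2 ∨ ∃ P ≤ H, P ≠ ⊥ ∧ IsPGroup 3 P ∧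
      ∀ h ∈ H, ∀ x ∈ P, h⁻¹ * x * h ∈ P := by
  by_cases hfour : ∃ P : Subgroup Γ, P ≤ H ∧ IsPGroup 2 P ∧ ∃ h ∈ H, P.conjugate h = P ∧
      ∃ a ∈ P, h * a ≠ a * h
  · obtain ⟨P, hPH, hP, h, hh, hhP, a, ha, hha⟩ := hfour
    exact Or.inl (four_case ax hPH hP hh hhP ha hha)
  obtain ⟨O, hOH, hO2, hOinv, -, hOpow⟩ := transfer_lemma Nat.prime_two H (by
    intro P hPH hP g hg hgP x hx
    by_contra hne
    exact hfour ⟨P, hPH, hP, g, hg, hgP, x, hx, hne⟩)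
  have ord_dvd : ∀ {K : Subgroup Γ} {x : Γ}, x ∈ K → orderOf x ∣ Nat.card K :=
    fun {K x} hx => K.orderOf_dvd_natCard hx
  have hOodd : ∀ g ∈ O, Odd (orderOf g) := by
    intro g hg
    rw [← Nat.not_even_iff_odd, even_iff_two_dvd]
    exact fun h => hO2 (h.trans (ord_dvd hg))
  have hex : ∀ p : {p : ℕ // p.Prime ∧ p ≠ 2 ∧ p ≠ 3}, ∃ N : Subgroup Γ, N ≤ O ∧
      ¬ p.1 ∣ Nat.card N ∧ (∀ k ∈ O, ∀ x ∈ N, k⁻¹ * x * k ∈ N) ∧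
      (∀ a ∈ O, ∀ b ∈ O, a⁻¹ * b⁻¹ * a * b ∈ N) ∧ ∀ k ∈ O, ∃ m, k ^ p.1 ^ m ∈ N := by
    rintro ⟨p, hp, hp2, hp3⟩
    exact transfer_lemma hp O (fun P _ hP g hg hgP x hx =>
      transfer_hyp ax hOodd hp hp2 hp3 P hP g hg hgP x hx)
  choose N hNO hNp _ hNc hNpow using hex
  obtain ⟨P, hPdef⟩ : ∃ P : Subgroup Γ, P = O ⊓ ⨅ p, N p := ⟨_, rfl⟩
  have memP : ∀ {x}, x ∈ P ↔ x ∈ O ∧ ∀ p, x ∈ N p := by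
    intro x; rw [hPdef, Subgroup.mem_inf, Subgroup.mem_iInf]
  have hP3 : ∀ x ∈ P, ∃ k, x ^ 3 ^ k = 1 := by
    intro x hx
    obtain ⟨hxO, hxN⟩ := memP.1 hx
    have : ∀ {d : ℕ}, d.Prime → d ∣ orderOf x → d = 3 := by
      intro d hd hdx
      by_contra hd3
      by_cases hd2 : d = 2
      · subst hd2
        exact hO2 (hdx.trans (ord_dvd hxO))
      · exact hNp ⟨d, hd, hd2, hd3⟩ (hdx.trans (ord_dvd (hxN ⟨d, hd, hd2, hd3⟩)))
    refine ⟨(orderOf x).primeFactorsList.length, ?_⟩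
    rw [← Nat.eq_prime_pow_of_unique_prime_dvd (orderOf_pos x).ne' this]
    exact pow_orderOf_eq_one x
  have h3P : ∀ x ∈ O, ∀ k, x ^ 3 ^ k = 1 → x ∈ P := by
    intro x hx k hk
    refine memP.2 ⟨hx, fun p => ?_⟩
    obtain ⟨m, hm⟩ := hNpow p x hx
    refine mem_of_pow_mem ?_ hk hm
    exact Nat.Coprime.pow _ _ ((Nat.coprime_primes Nat.prime_three p.2.1).2 p.2.2.2.symm)
  by_cases hPb : P ≠ ⊥
  · right; right
    refine ⟨P, fun x hx => hOH (memP.1 hx).1, hPb, isPGroup_iff.2 hP3, ?_⟩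
    intro h hh x hx
    obtain ⟨k, hk⟩ := hP3 x hx
    refine h3P _ (hOinv h hh x (memP.1 hx).1) k ?_
    rw [conj_pow', hk]; group
  push Not at hPb
  by_cases hOb : O = ⊥
  · -- `H` is a 2-group
    have hH2 : IsPGroup 2 H := by
      rw [isPGroup_iff]
      intro x hx
      obtain ⟨m, hm⟩ := hOpow x hx
      rw [hOb, Subgroup.mem_bot] at hm
      exact ⟨m, hm⟩
    by_cases hHb : H = ⊥
    · left
      intro g
      refine ⟨1, Subgroup.one_mem _, ?_⟩
      rw [conjugate_one, hHb]
      symm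
      apply conjugate_eq_of_forall
      intro x hx
      rw [Subgroup.mem_bot] at hx ⊢
      rw [hx]; group
    obtain ⟨⟨a, ha⟩, hane⟩ := Subgroup.ne_bot_iff_exists_ne_one.1 hHb
    have ha1 : a ≠ 1 := fun e => hane (Subtype.ext e)
    by_cases hb : ∃ b ∈ H, b ≠ 1 ∧ a ≠ b
    · obtain ⟨b, hb, hb1, hab⟩ := hb
      left
      apply pron_red_one
      exact sylow_red Nat.prime_two hH2 le_rfl (four_max ax ha hb ha1 hb1 hab)
    · right; left
      rw [Nat.card_eq_two_iff]
      refine ⟨1, ⟨a, ha⟩, ?_, ?_⟩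
      · intro e; exact ha1 (congrArg Subtype.val e).symm
      · ext y
        simp only [Set.mem_insert_iff, Set.mem_singleton_iff, Set.mem_univ, iff_true]
        by_contra! hy
        exact hb ⟨y, y.2, fun e => hy.1 (Subtype.ext e), fun e => hy.2 (Subtype.ext e.symm)⟩
  · left
    have hOab : ∀ x ∈ O, ∀ y ∈ O, x * y = y * x := by
      intro x hx y hy
      have : x⁻¹ * y⁻¹ * x * y ∈ P := by
        refine memP.2 ⟨?_, fun p => hNc p x hx y hy⟩
        exact O.mul_mem (O.mul_mem (O.mul_mem (O.inv_mem hx) (O.inv_mem hy)) hx) hy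
      rw [hPb, Subgroup.mem_bot] at this
      calc x * y = y * x * (x⁻¹ * y⁻¹ * x * y) := by group
        _ = y * x := by rw [this, mul_one]
    have hcard : Nat.card O ≠ 1 := fun h => hOb (Subgroup.card_eq_one.1 h)
    obtain ⟨p, hp, hpd⟩ := Nat.exists_prime_and_dvd hcard
    have := Fact.mk hp
    obtain ⟨x, hx⟩ := exists_prime_orderOf_dvd_card' p hpd
    have hx' : orderOf (x : Γ) = p := by rw [← hx]; exact Subgroup.orderOf_coe x
    have hxp : (x : Γ) ^ p = 1 := by rw [← hx']; exact pow_orderOf_eq_one _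
    have hx1 : (x : Γ) ≠ 1 := by
      intro e
      rw [e, orderOf_one] at hx'
      exact hp.ne_one hx'.symm
    have hp2 : p ≠ 2 := by rintro rfl; exact hO2 hpd
    have hp3 : p ≠ 3 := by
      rintro rfl
      have := h3P x x.2 1 (by simpa using hxp)
      rw [hPb, Subgroup.mem_bot] at this
      exact hx1 this
    exact torus_case ax hp hp2 hp3 (hOH x.2) hxp hx1
      (fun h hh => hOab x x.2 _ (hOinv h hh x x.2))

end abs2
end PronPSL

namespace PronPSL
open Matrix
section fin
variable {F : Type*} [Field F]


lemma uu_inv (s : F) : (uu s)⁻¹ = uu (-s) := by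
  apply inv_eq_of_mul_eq_one_left
  rw [uu_mul, neg_add_cancel, uu_zero]

/-- the unipotent upper triangular subgroup -/
def UU (F : Type*) [Field F] : Subgroup (ProjectiveSpecialLinearGroup (Fin 2) F) where
  carrier := Set.range uu
  mul_mem' := by
    rintro _ _ ⟨s, rfl⟩ ⟨t, rfl⟩
    exact ⟨s + t, (uu_mul s t).symm⟩
  one_mem' := ⟨0, uu_zero⟩
  inv_mem' := by
    rintro _ ⟨s, rfl⟩
    exact ⟨-s, (uu_inv s).symm⟩

lemma mem_UU {x : (ProjectiveSpecialLinearGroup (Fin 2) F)} : x ∈ UU F ↔ ∃ s, uu s = x := Iff.rfl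

/-- the additive subgroup of `F` of unipotent elements of `H` -/
def SS (H : Subgroup (ProjectiveSpecialLinearGroup (Fin 2) F)) : AddSubgroup F where
  carrier := {s | uu s ∈ H}
  add_mem' := by
    intro a b ha hb
    show uu (a + b) ∈ H
    rw [← uu_mul]; exact H.mul_mem ha hb
  zero_mem' := by
    show uu 0 ∈ H
    rw [uu_zero]; exact H.one_mem
  neg_mem' := by
    intro a ha
    show uu (-a) ∈ H
    rw [← uu_inv]; exact H.inv_mem ha

lemma mem_SS {H : Subgroup (ProjectiveSpecialLinearGroup (Fin 2) F)} {s : F} : s ∈ SS H ↔ uu s ∈ H := Iff.rfl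

lemma UU_three (h3 : (3 : F) = 0) : IsPGroup 3 (UU F) := by
  rw [isPGroup_iff]
  rintro _ ⟨s, rfl⟩
  refine ⟨1, ?_⟩
  rw [pow_one, pow_succ, pow_two, uu_mul, uu_mul, ← uu_zero]
  congr 1
  linear_combination s * h3

lemma UU_max [Finite (ProjectiveSpecialLinearGroup (Fin 2) F)] (two : (2 : F) ≠ 0) (Q : Subgroup (ProjectiveSpecialLinearGroup (Fin 2) F)) (hQ : IsPGroup 3 Q) (hUQ : UU F ≤ Q) :
    Q ≤ UU F := by
  have h1 : uu (1 : F) ∈ Q := hUQ ⟨1, rfl⟩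
  have h11 : uu (1 : F) ≠ 1 := by
    rw [← uu_zero, Ne, uu_eq two]; exact one_ne_zero
  obtain ⟨z, hz, hz1, hzc⟩ := center_elt Nat.prime_three hQ (by
    intro e; rw [e] at h1; exact h11 (Subgroup.mem_bot.1 h1))
  obtain ⟨t, rfl⟩ := comm_uu two one_ne_zero (hzc _ h1).symm
  have ht : t ≠ 0 := by rintro rfl; exact hz1 uu_zero
  intro x hx
  obtain ⟨s, rfl⟩ := comm_uu two ht (hzc x hx)
  exact ⟨s, rfl⟩

lemma conj_into_UU [Finite (ProjectiveSpecialLinearGroup (Fin 2) F)] (two : (2 : F) ≠ 0) (h3 : (3 : F) = 0) {P : Subgroup (ProjectiveSpecialLinearGroup (Fin 2) F)}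
    (hP : IsPGroup 3 P) : ∃ y : (ProjectiveSpecialLinearGroup (Fin 2) F), P.conjugate y ≤ UU F := by
  obtain ⟨k, -, S, hS, -, h1, h2⟩ := sylow_in (K := ⊤) Nat.prime_three (UU_three h3) hP le_top le_top
  exact ⟨k, h2.trans (UU_max two S hS h1)⟩

lemma isUp_conj {x : (ProjectiveSpecialLinearGroup (Fin 2) F)} (hx : IsUp x) : (UU F).conjugate x ≤ UU F := by
  obtain ⟨a, b, d, h, rfl⟩ := hx
  intro y hy
  rw [mem_conjugate] at hy
  obtain ⟨s, hs⟩ := hy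
  refine ⟨s * d ^ 2, ?_⟩
  rw [← conj_uu h, hs]; group

lemma borel_pron [Finite (ProjectiveSpecialLinearGroup (Fin 2) F)] (two : (2 : F) ≠ 0) (h3 : (3 : F) = 0) {H : Subgroup (ProjectiveSpecialLinearGroup (Fin 2) F)}
    (hU : UU F ≤ H) (hup : ∀ x ∈ H, IsUp x) : IsPronormal H := by
  apply pron_red_one
  intro g
  obtain ⟨k, hk, e⟩ := sylow_red Nat.prime_three (UU_three h3) hU (UU_max two) g
  refine ⟨k, hk, ?_⟩
  obtain ⟨t, ht⟩ := conj_pres e (show uu (1 : F) ∈ UU F from ⟨1, rfl⟩)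
  have hgk : IsUp (g * k) := up_of_conj one_ne_zero ht.symm
  apply conjugate_eq_of_forall
  intro x hx
  obtain ⟨s, hs⟩ := up_comm hgk (hup x hx)
  rw [hs]
  exact H.mul_mem hx (hU ⟨s, rfl⟩)

lemma elem_iso [Fintype F] [CharP F 3] (two : (2 : F) ≠ 0) {n : ℕ} (hF : Fintype.card F = 3 ^ n)
    {H : Subgroup (ProjectiveSpecialLinearGroup (Fin 2) F)} (hHU : H ≤ UU F) (hb : H ≠ ⊥) (ht : H ≠ UU F) :
    ∃ j : ℕ, 1 ≤ j ∧ j < n ∧ Nonempty (H ≃* (Fin j → Multiplicative (ZMod 3))) := by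
  have := Fact.mk Nat.prime_three
  let alg : Algebra (ZMod 3) F := ZMod.algebra F 3
  let M : Submodule (ZMod 3) F := AddSubgroup.toZModSubmodule 3 (SS H)
  have memM : ∀ s, s ∈ M ↔ uu s ∈ H := fun s => AddSubgroup.mem_toZModSubmodule 3
  have hfr : Module.finrank (ZMod 3) F = n := by
    have := Module.card_eq_pow_finrank (K := ZMod 3) (V := F)
    rw [hF, ZMod.card] at this
    exact (Nat.pow_right_injective (le_refl _ |>.trans (by norm_num)) this).symm
  refine ⟨Module.finrank (ZMod 3) M, ?_, ?_, ?_⟩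
  · rw [Submodule.one_le_finrank_iff]
    intro e
    apply hb
    rw [eq_bot_iff]
    intro x hx
    obtain ⟨s, rfl⟩ := hHU hx
    have : s ∈ M := (memM s).2 hx
    rw [e, Submodule.mem_bot] at this
    rw [this, uu_zero]; exact Subgroup.one_mem _
  · rw [← hfr]
    apply Submodule.finrank_lt
    intro e
    apply ht
    apply le_antisymm hHU
    rintro _ ⟨s, rfl⟩
    rw [← memM, e]; trivial
  · let e := (Module.finBasis (ZMod 3) M).equivFun
    let f : (Fin (Module.finrank (ZMod 3) M) → Multiplicative (ZMod 3)) →* H :=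
      { toFun := fun v => ⟨uu (e.symm (fun i => (v i).toAdd) : F), (memM _).1 (e.symm _).2⟩
        map_one' := by
          apply Subtype.ext
          show uu ((e.symm 0 : M) : F) = 1
          rw [map_zero]; exact uu_zero
        map_mul' := by
          intro v w
          apply Subtype.ext
          show uu ((e.symm ((fun i => (v i).toAdd) + (fun i => (w i).toAdd)) : M) : F) =
            uu (e.symm (fun i => (v i).toAdd) : F) * uu (e.symm (fun i => (w i).toAdd) : F)
          rw [map_add, uu_mul]; rfl }
    refine ⟨(MulEquiv.ofBijective f ⟨?_, ?_⟩).symm⟩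
    · intro v w hvw
      have h1 : uu (e.symm (fun i => (v i).toAdd) : F) = uu (e.symm (fun i => (w i).toAdd) : F) :=
        congrArg Subtype.val hvw
      rw [uu_eq two] at h1
      have h2 := e.symm.injective (Subtype.ext h1)
      funext i
      exact congrFun h2 i
    · rintro ⟨x, hx⟩
      obtain ⟨s, rfl⟩ := hHU hx
      refine ⟨fun i => Multiplicative.ofAdd (e ⟨s, (memM s).2 hx⟩ i), ?_⟩
      apply Subtype.ext
      show uu ((e.symm (e ⟨s, (memM s).2 hx⟩) : M) : F) = uu s
      rw [LinearEquiv.symm_apply_apply]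

lemma zmod3_cases : ∀ c : ZMod 3, c = 0 ∨ c = 1 ∨ c = -1 := by decide

/-- no proper stable subgroup -/
lemma SS_top [Fintype F] [CharP F 3] {n : ℕ} (hn : n.Prime) (hF : Fintype.card F = 3 ^ n)
    (S : AddSubgroup F) {s0 : F} (hs0 : s0 ∈ S) (hs : s0 ≠ 0) {r : F} (hr : ∀ s ∈ S, s * r ∈ S)
    (h0 : r ≠ 0) (h1 : r ≠ 1) (hm1 : r ≠ -1) (s : F) : s ∈ S := by
  have := Fact.mk Nat.prime_three
  let alg : Algebra (ZMod 3) F := ZMod.algebra F 3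
  let M : Submodule (ZMod 3) F := AddSubgroup.toZModSubmodule 3 S
  have memM : ∀ s, s ∈ M ↔ s ∈ S := fun s => AddSubgroup.mem_toZModSubmodule 3
  have hfr : Module.finrank (ZMod 3) F = n := by
    have := Module.card_eq_pow_finrank (K := ZMod 3) (V := F)
    rw [hF, ZMod.card] at this
    exact (Nat.pow_right_injective (le_refl _ |>.trans (by norm_num)) this).symm
  let R : Subalgebra (ZMod 3) F :=
    { carrier := {t | ∀ s ∈ S, s * t ∈ S}
      mul_mem' := by
        intro a b ha hb s hs
        rw [← mul_assoc]; exact hb _ (ha s hs)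
      add_mem' := by
        intro a b ha hb s hs
        rw [mul_add]; exact S.add_mem (ha s hs) (hb s hs)
      algebraMap_mem' := by
        intro c s hs
        rw [mul_comm, ← Algebra.smul_def, ← memM]
        exact M.smul_mem c ((memM s).2 hs) }
  have hsimp := Subalgebra.isSimpleOrder_of_finrank_prime (ZMod 3) F (by rwa [hfr])
  rcases hsimp.eq_bot_or_eq_top R with hR | hR
  · exfalso
    have hrR : r ∈ R := hr
    rw [hR, Algebra.mem_bot] at hrR
    obtain ⟨c, hc⟩ := hrR
    have : c = 0 ∨ c = 1 ∨ c = -1 := zmod3_cases c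
    rcases this with rfl | rfl | rfl
    · exact h0 (by rw [← hc, map_zero])
    · exact h1 (by rw [← hc, map_one])
    · exact hm1 (by rw [← hc, map_neg, map_one])
  · have : s0⁻¹ * s ∈ R := by rw [hR]; trivial
    have := this s0 hs0
    rwa [← mul_assoc, mul_inv_cancel₀ hs, one_mul] at this

lemma conj_iso {Γ : Type*} [Group Γ] (H : Subgroup Γ) (y : Γ) : Nonempty (H ≃* H.conjugate y) :=
  ⟨H.equivMapOfInjective (MulAut.conj y⁻¹).toMonoidHom (MulAut.conj y⁻¹).injective⟩

lemma three_case [Fintype F] [CharP F 3] [Finite (ProjectiveSpecialLinearGroup (Fin 2) F)] (two : (2 : F) ≠ 0) (h3 : (3 : F) = 0)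
    (hns : ∀ r : F, r ^ 2 ≠ -1) {n : ℕ} (hn : n.Prime) (hF : Fintype.card F = 3 ^ n)
    {H P : Subgroup (ProjectiveSpecialLinearGroup (Fin 2) F)} (hPH : P ≤ H) (hPb : P ≠ ⊥) (hP : IsPGroup 3 P)
    (hinv : ∀ h ∈ H, ∀ x ∈ P, h⁻¹ * x * h ∈ P) : IsPronormal H ∨
    ∃ j : ℕ, 1 ≤ j ∧ j < n ∧ Nonempty (H ≃* (Fin j → Multiplicative (ZMod 3))) := by
  obtain ⟨y, hy⟩ := conj_into_UU two h3 hP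
  obtain ⟨⟨x, hx⟩, hxne⟩ := Subgroup.ne_bot_iff_exists_ne_one.1 hPb
  have hx1 : x ≠ 1 := fun e => hxne (Subtype.ext e)
  obtain ⟨s0, hs0⟩ := hy (conj_mem_conjugate (g := y) hx)
  have hs0ne : s0 ≠ 0 := by
    rintro rfl
    rw [uu_zero] at hs0
    exact hx1 (conj_inj (g := y) (by rw [← hs0]; group))
  have hPH' : P.conjugate y ≤ H.conjugate y := conjugate_mono hPH
  have hs0P : uu s0 ∈ P.conjugate y := by rw [hs0]; exact conj_mem_conjugate hx
  have hs0H : uu s0 ∈ H.conjugate y := hPH' hs0P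
  have hup : ∀ h ∈ H.conjugate y, IsUp h := by
    intro h hh
    have : h⁻¹ * uu s0 * h ∈ P.conjugate y := by
      rw [mem_conjugate] at hh hs0P ⊢
      have := hinv _ hh _ hs0P
      have e : (y * h * y⁻¹)⁻¹ * (y * uu s0 * y⁻¹) * (y * h * y⁻¹) =
        y * (h⁻¹ * uu s0 * h) * y⁻¹ := by group
      rwa [e] at this
    obtain ⟨t, ht⟩ := hy this
    exact up_of_conj hs0ne ht.symm
  by_cases hU : UU F ≤ H.conjugate y
  · left
    exact (pron_conj_iff y).1 (borel_pron two h3 hU hup)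
  right
  have hHU : H.conjugate y ≤ UU F := by
    intro h hh
    obtain ⟨a, b, d, hd, rfl⟩ := hup h hh
    by_cases hd1 : d ^ 2 = 1
    · obtain ⟨t, ht⟩ := up_unip hd hd1
      exact ⟨t, ht.symm⟩
    · exfalso
      apply hU
      rintro _ ⟨s, rfl⟩
      rw [← mem_SS]
      refine SS_top hn hF (SS (H.conjugate y)) (s0 := s0) hs0H hs0ne (r := d ^ 2) ?_ ?_ hd1 (hns d) s
      · intro s hs
        rw [mem_SS, ← conj_uu hd]
        exact Subgroup.mul_mem _ (Subgroup.mul_mem _ (Subgroup.inv_mem _ hh) hs) hh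
      · intro e
        have : d = 0 := by simpa using e
        rw [this] at hd; simp at hd
  obtain ⟨j, hj1, hjn, ⟨e⟩⟩ := elem_iso two hF hHU (by
    intro e
    rw [e, Subgroup.mem_bot, ← uu_zero, uu_eq two] at hs0H
    exact hs0ne hs0H) (by
    intro e; exact hU e.ge)
  obtain ⟨e'⟩ := conj_iso H y
  exact ⟨j, hj1, hjn, ⟨e'.trans e⟩⟩

lemma two_not (hns : ∀ r : F, r ^ 2 ≠ -1) (h3 : (3 : F) = 0) {H : Subgroup (ProjectiveSpecialLinearGroup (Fin 2) F)}
    (hH : Nat.card H = 2) : ¬ IsPronormal H := by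
  intro hp
  have hHb : H ≠ ⊥ := by rintro rfl; simp at hH
  obtain ⟨⟨t, ht⟩, htne⟩ := Subgroup.ne_bot_iff_exists_ne_one.1 hHb
  have ht1 : t ≠ 1 := fun e => htne (Subtype.ext e)
  have hall : ∀ y ∈ H, y = 1 ∨ y = t := by
    intro y hy
    obtain ⟨u, v, -, huv⟩ := Nat.card_eq_two_iff.1 hH
    have hm : ∀ z : H, z = u ∨ z = v := by
      intro z
      have : z ∈ ({u, v} : Set H) := by rw [huv]; trivial
      simpa using this
    have h1 := hm 1
    have h2 := hm ⟨t, ht⟩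
    have h4 := hm ⟨y, hy⟩
    have : (⟨y, hy⟩ : H) = 1 ∨ (⟨y, hy⟩ : H) = ⟨t, ht⟩ := by grind
    exact this.imp (congrArg Subtype.val) (congrArg Subtype.val)
  have ht2 : t ^ 2 = 1 := by
    rcases hall _ (H.pow_mem ht 2) with h | h
    · exact h
    · exact absurd (by simpa [pow_two] using h) ht1
  obtain ⟨g, hg, hc⟩ := fM6 hns h3 ht2 ht1
  obtain ⟨x, hx, hxe⟩ := hp g
  have hle : H ⊔ H.conjugate g ≤ Subgroup.centralizer {t} := by
    apply sup_le
    · intro y hy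
      rw [Subgroup.mem_centralizer_singleton_iff]
      rcases hall y hy with rfl | rfl <;> simp
    · intro y hy
      rw [Subgroup.mem_centralizer_singleton_iff]
      rw [mem_conjugate] at hy
      rcases hall _ hy with e | e
      · have : y = 1 := by
          have : y = g⁻¹ * (g * y * g⁻¹) * g := by group
          rw [this, e]; group
        rw [this]; simp
      · have : y = g⁻¹ * t * g := by rw [← e]; group
        rw [this]
        first
        | exact hc
        | exact hc.symm
  have hxt : x⁻¹ * t * x = t := by
    rw [conj_eq_iff_comm]
    have := Subgroup.mem_centralizer_singleton_iff.1 (hle hx)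
    first
    | exact this
    | exact this.symm
  have h1 : g⁻¹ * t * g ∈ H.conjugate x := by rw [hxe]; exact conj_mem_conjugate ht
  rw [mem_conjugate] at h1
  rcases hall _ h1 with e | e
  · have e1 : g⁻¹ * t * g = 1 := by
      calc g⁻¹ * t * g = x⁻¹ * (x * (g⁻¹ * t * g) * x⁻¹) * x := by group
        _ = 1 := by rw [e]; group
    exact ht1 (conj_inj (g := g) (by rw [e1]; group))
  · apply hg
    calc g⁻¹ * t * g = x⁻¹ * (x * (g⁻¹ * t * g) * x⁻¹) * x := by group
      _ = t := by rw [e, hxt]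

lemma elem_not [Fintype F] [Finite (ProjectiveSpecialLinearGroup (Fin 2) F)] (two : (2 : F) ≠ 0) (h3 : (3 : F) = 0) {n : ℕ}
    (hF : Fintype.card F = 3 ^ n) {H : Subgroup (ProjectiveSpecialLinearGroup (Fin 2) F)} {j : ℕ} (hj1 : 1 ≤ j) (hjn : j < n)
    (e : H ≃* (Fin j → Multiplicative (ZMod 3))) : ¬ IsPronormal H := by
  intro hp
  have hcard : Nat.card H = 3 ^ j := by
    rw [Nat.card_congr e.toEquiv, Nat.card_fun]
    have : Nat.card (Multiplicative (ZMod 3)) = 3 := Nat.card_zmod 3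
    rw [this]; simp
  obtain ⟨y, hy⟩ := conj_into_UU two h3 (IsPGroup.of_card hcard)
  have hp' := pron_conj y hp
  have hcard' : Nat.card (H.conjugate y) = 3 ^ j := by rw [card_conjugate, hcard]
  obtain ⟨K, hK⟩ : ∃ K, K = H.conjugate y := ⟨_, rfl⟩
  rw [← hK] at hy hp' hcard'
  have hinv : ∀ g : (ProjectiveSpecialLinearGroup (Fin 2) F), IsUp g → K.conjugate g = K := by
    intro g hg
    obtain ⟨x, hx, hxe⟩ := hp' g
    rw [← hxe]
    have hxU : x ∈ UU F := (sup_le hy ((conjugate_mono hy).trans (isUp_conj hg))) hx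
    obtain ⟨s, rfl⟩ := hxU
    apply conjugate_eq_of_forall
    intro z hz
    obtain ⟨t, rfl⟩ := hy hz
    rw [conj_eq_iff_comm.2 (by rw [uu_mul, uu_mul, add_comm])]
    exact hz
  have hsq : ∀ s ∈ SS K, ∀ d : F, s * d ^ 2 ∈ SS K := by
    intro s hs d
    by_cases hd : d = 0
    · rw [hd]; simp
    · have h : d⁻¹ * d - 0 * 0 = 1 := by rw [inv_mul_cancel₀ hd]; ring
      rw [mem_SS, ← conj_uu h]
      exact conj_pres (hinv _ ⟨_, _, _, h, rfl⟩) hs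
  have hKb : K ≠ ⊥ := by
    rintro rfl
    rw [Subgroup.card_bot] at hcard'
    have : 1 < 3 ^ j := Nat.one_lt_pow (by omega) (by norm_num)
    omega
  obtain ⟨⟨x, hx⟩, hxne⟩ := Subgroup.ne_bot_iff_exists_ne_one.1 hKb
  obtain ⟨s0, rfl⟩ := hy hx
  have hs0 : s0 ≠ 0 := by rintro rfl; exact hxne (Subtype.ext uu_zero)
  have hall : ∀ s : F, uu s ∈ K := by
    intro s
    have h1 := (SS K).sub_mem (hsq s0 hx ((s / s0 + 1) / 2)) (hsq s0 hx ((s / s0 - 1) / 2))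
    have h2 : s0 * ((s / s0 + 1) / 2) ^ 2 - s0 * ((s / s0 - 1) / 2) ^ 2 = s := by
      field_simp
      ring
    rwa [h2] at h1
  have hinj : Function.Injective (fun s : F => (⟨uu s, hall s⟩ : K)) := by
    intro s t hst
    exact (uu_eq two).1 (congrArg Subtype.val hst)
  have := Nat.card_le_card_of_injective _ hinj
  rw [hcard', Nat.card_eq_fintype_card, hF] at this
  exact absurd this (not_le.2 (Nat.pow_lt_pow_right (by norm_num) hjn))

end fin

theorem main (n : ℕ) (hn : n.Prime) (hodd : Odd n) (F : Type*) [Field F] [Fintype F]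
    (hF : Fintype.card F = 3 ^ n)
    (H : Subgroup (Matrix.ProjectiveSpecialLinearGroup (Fin 2) F)) :
    ¬ IsPronormal H ↔
      (Nat.card H = 2 ∨
        ∃ j : ℕ, 1 ≤ j ∧ j < n ∧
          Nonempty (H ≃* (Fin j → Multiplicative (ZMod 3)))) := by
  have h3 : (3 : F) = 0 := by
    have := Nat.cast_card_eq_zero F
    rw [hF] at this
    push_cast at this
    exact pow_eq_zero_iff hn.ne_zero |>.1 this
  have two : (2 : F) ≠ 0 := fun h => one_ne_zero (α := F) (by linear_combination h3 - h)
  have hns : ∀ r : F, r ^ 2 ≠ -1 := by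
    intro r hr
    have : IsSquare (-1 : F) := ⟨r, by rw [← hr, pow_two]⟩
    rw [FiniteField.isSquare_neg_one_iff, hF] at this
    apply this
    obtain ⟨m, rfl⟩ := hodd
    rw [pow_succ, pow_mul, Nat.mul_mod, Nat.pow_mod]
    norm_num
  have hchar : CharP F 3 := by
    have := Fact.mk Nat.prime_three
    exact charP_of_card_eq_prime_pow hF
  have ax : Ax (Matrix.ProjectiveSpecialLinearGroup (Fin 2) F) :=
    { m1 := fM1 two
      m2 := fM2 h3
      m3 := fM3 hns h3
      m4 := fM4 two
      m5 := fM5 two }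
  constructor
  · intro hnp
    rcases abs_main ax H with h | h | ⟨P, hPH, hPb, hP, hinv⟩
    · exact absurd h hnp
    · exact Or.inl h
    · exact Or.inr ((three_case two h3 hns hn hF hPH hPb hP hinv).resolve_left hnp)
  · rintro (h | ⟨j, hj1, hjn, ⟨e⟩⟩)
    · exact two_not hns h3 h
    · exact elem_not two h3 hF hj1 hjn e

end PronPSL

theorem stmt1 (n : ℕ) (hn : n.Prime) (hodd : Odd n) (F : Type*) [Field F] [Fintype F]
    (hF : Fintype.card F = 3 ^ n)
    (H : Subgroup (Matrix.ProjectiveSpecialLinearGroup (Fin 2) F)) :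
    ¬ IsPronormal H ↔
      (Nat.card H = 2 ∨
        ∃ j : ℕ, 1 ≤ j ∧ j < n ∧
          Nonempty (H ≃* (Fin j → Multiplicative (ZMod 3)))) := by
  exact PronPSL.main n hn hodd F hF H
end
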